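/- arXiv:2406.11379 — 2 statements merged into one kernel-verified Lean document; each statement's English description precedes it below -/
import Mathlib

section
/- (Continuity of the boundary streamline.) There exists a constant M₁ > 0 such that for every M ∈ (0, M₁), every W > 0, and every ω ∈ S_M satisfying the Steiner symmetry condition with ω = 1_Ω where Ω := {x ∈ ℝ²₊ : 𝒢[ω](x) − W·x₂ > 0} (an open bounded set), the following hold. Let A := {y₂ > 0 : (0,y₂) ∈ Ω}. Then: (i) A is a nonempty bounded open subset of (0,∞) and contains an interval (0,ε) for some ε > 0, and there is a function l : (0,∞) → [0,∞) with {y₁ ∈ ℝ : (y₁,y₂) ∈ Ω} = (−l(y₂), l(y₂)) for every y₂ ∈ A and l(y₂) = 0 for every y₂ ∈ (0,∞)∖A; (ii) l is continuous on (0,∞), is continuously differentiable on A with derivative locally Hölder continuous of every exponent r ∈ (0,1), and 𝒢[ω](l(y₂), y₂) = W·y₂ for every y₂ ∈ A; (iii) the limit lim_{y₂→0⁺} l(y₂) exists and belongs to (0,∞). -/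
open MeasureTheory Real Set NNReal Filter Topology

noncomputable section

/-- The upper half plane `ℝ²₊`. -/
def H : Set (ℝ × ℝ) := {p | 0 < p.2}

/-- The half-plane Green function
`G(x,y) = (1/(4π)) log(1 + 4 x₂ y₂ / |x-y|²)` (Euclidean distance). -/
def G (x y : ℝ × ℝ) : ℝ :=
  (1 / (4 * π)) * Real.log (1 + 4 * x.2 * y.2 / ((x.1 - y.1) ^ 2 + (x.2 - y.2) ^ 2))

/-- The potential `𝒢[ω](x) = ∫_{ℝ²₊} G(x,y) ω(y) dy`. -/
def Gpot (ω : ℝ × ℝ → ℝ) (x : ℝ × ℝ) : ℝ := ∫ y in H, G x y * ω y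

/-- The kinetic energy `E(ω) = (1/2) ∫∫ G(x,y) ω(x) ω(y) dy dx`. -/
def energy (ω : ℝ × ℝ → ℝ) : ℝ :=
  (1 / 2) * ∫ x in H, ∫ y in H, G x y * ω x * ω y

/-- The `L¹(ℝ²₊)` norm (mass). -/
def norm1 (ω : ℝ × ℝ → ℝ) : ℝ := ∫ x in H, |ω x|

/-- The `L²(ℝ²₊)` norm. -/
def norm2 (ω : ℝ × ℝ → ℝ) : ℝ := (∫ x in H, ω x ^ 2) ^ ((1 : ℝ) / 2)

/-- The impulse `‖x₂ ω‖₁ = ∫_{ℝ²₊} x₂ |ω(x)| dx`. -/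
def impulse (ω : ℝ × ℝ → ℝ) : ℝ := ∫ x in H, x.2 * |ω x|

/-- `ω ∈ (L¹ ∩ L²)(ℝ²₊)`. -/
def MemL1L2 (ω : ℝ × ℝ → ℝ) : Prop :=
  Integrable ω (volume.restrict H) ∧ Integrable (fun x => ω x ^ 2) (volume.restrict H)

/-- Finiteness of the impulse `‖x₂ ω‖₁ < ∞`. -/
def ImpulseFinite (ω : ℝ × ℝ → ℝ) : Prop :=
  Integrable (fun x : ℝ × ℝ => x.2 * |ω x|) (volume.restrict H)

/-- The admissible class `K_M`: patches `ω = 1_A` a.e. on `ℝ²₊` with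
impulse `∫_A x₂ = M` and mass `|A| ≤ 1`. -/
def memK (M : ℝ) (ω : ℝ × ℝ → ℝ) : Prop :=
  Integrable ω (volume.restrict H) ∧
  ∃ A : Set (ℝ × ℝ), A ⊆ H ∧ MeasurableSet A ∧
    (∀ᵐ x ∂volume.restrict H, ω x = A.indicator (fun _ => (1 : ℝ)) x) ∧
    (∫ x in A, x.2) = M ∧ volume A ≤ 1

/-- The admissible class `K_{M,∞}`: patches `ω = 1_A` a.e. on `ℝ²₊` with
impulse `∫_A x₂ = M`, without any mass bound. -/
def memKinf (M : ℝ) (ω : ℝ × ℝ → ℝ) : Prop :=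
  Integrable ω (volume.restrict H) ∧
  ∃ A : Set (ℝ × ℝ), A ⊆ H ∧ MeasurableSet A ∧
    (∀ᵐ x ∂volume.restrict H, ω x = A.indicator (fun _ => (1 : ℝ)) x) ∧
    (∫ x in A, x.2) = M

/-- The relaxed admissible class `K̃_M`: measurable `0 ≤ ω ≤ 1` with
mass `≤ 1` and impulse `≤ M`. -/
def memKt (M : ℝ) (ω : ℝ × ℝ → ℝ) : Prop :=
  Integrable ω (volume.restrict H) ∧
  (∀ᵐ x ∂volume.restrict H, 0 ≤ ω x ∧ ω x ≤ 1) ∧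
  norm1 ω ≤ 1 ∧
  Integrable (fun x : ℝ × ℝ => x.2 * |ω x|) (volume.restrict H) ∧
  impulse ω ≤ M

/-- The set of maximizers `S_M` of the energy over `K_M`. -/
def memS (M : ℝ) (ω : ℝ × ℝ → ℝ) : Prop :=
  memK M ω ∧ ∀ ω' : ℝ × ℝ → ℝ, memK M ω' → energy ω' ≤ energy ω

/-- The maximal energy `I_M` over `K_M`. -/
def Isup (M : ℝ) : ℝ := sSup (energy '' {ω | memK M ω})

/-- The maximal energy `I_{1,∞}` over `K_{1,∞}`. -/
def IsupInf : ℝ := sSup (energy '' {ω | memKinf 1 ω})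

/-- The Steiner symmetry condition for a set `Ω ⊆ ℝ²₊`. -/
def SteinerSet (Ω : Set (ℝ × ℝ)) : Prop :=
  (∀ x₁ x₂ : ℝ, 0 < x₂ → (((x₁, x₂) : ℝ × ℝ) ∈ Ω ↔ ((-x₁, x₂) : ℝ × ℝ) ∈ Ω)) ∧
  (∀ x₂ : ℝ, 0 < x₂ → ∀ a b : ℝ, 0 ≤ a → a ≤ b →
    ((b, x₂) : ℝ × ℝ) ∈ Ω → ((a, x₂) : ℝ × ℝ) ∈ Ω)

/-- The Steiner symmetry condition for a nonnegative function on `ℝ²₊`. -/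
def SteinerFn (f : ℝ × ℝ → ℝ) : Prop :=
  (∀ x₁ x₂ : ℝ, 0 < x₂ → f (x₁, x₂) = f (-x₁, x₂)) ∧
  (∀ x₂ : ℝ, 0 < x₂ → ∀ a b : ℝ, 0 ≤ a → a ≤ b → f (b, x₂) ≤ f (a, x₂))

/-- The real-linear identification of `ℝ × ℝ` with `ℂ`. -/
def cx : ℝ × ℝ →L[ℝ] ℂ := Complex.equivRealProdCLM.symm

@[simp] lemma cx_re (x : ℝ × ℝ) : (cx x).re = x.1 := by simp [cx]

@[simp] lemma cx_im (x : ℝ × ℝ) : (cx x).im = x.2 := by simp [cx]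

lemma measurable_cx : Measurable cx := cx.continuous.measurable

lemma measurePreserving_cx : MeasurePreserving cx volume volume := by
  have h := Complex.volume_preserving_equiv_real_prod.symm
  convert! h using 1

lemma norm_cx_sq (x : ℝ × ℝ) : ‖cx x‖ ^ 2 = x.1 ^ 2 + x.2 ^ 2 := by
  rw [Complex.sq_norm, Complex.normSq_apply]; simp; ring

lemma ae_ne_cx (z : ℂ) : ∀ᵐ y : ℝ × ℝ, z - cx y ≠ 0 := by
  have h : ∀ᵐ w : ℂ, w ≠ z := by simp [ae_iff]
  filter_upwards [measurePreserving_cx.quasiMeasurePreserving.ae h] with y hy h0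
  exact hy (sub_eq_zero.mp h0).symm

lemma integrable_rpow_neg_norm_near_zero {p : ℝ} (hp : p < 2) :
    Integrable ((Metric.ball (0 : ℂ) 1).indicator fun w => ‖w‖ ^ (-p)) := by
  rw [integrable_indicator_iff Metric.isOpen_ball.measurableSet]
  rw [integrableOn_fun_norm_addHaar volume (f := fun t : ℝ => t ^ (-p))]
  rw [Complex.finrank_real_complex]
  have h : IntegrableOn (fun t : ℝ => t ^ (1 - p)) (Ioo 0 1) :=
    (intervalIntegral.integrableOn_Ioo_rpow_iff one_pos).2 (by linarith)
  refine h.congr_fun (fun t ht => ?_) measurableSet_Ioo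
  simp only [Nat.add_one_sub_one, pow_one, smul_eq_mul]
  rw [sub_eq_add_neg, Real.rpow_add ht.1, Real.rpow_one]

/-- Uniform bound for the Riesz-type potentials of a set of finite measure. -/
lemma exists_riesz_bound {S : Set (ℝ × ℝ)} (hS : volume S ≠ ⊤) {p : ℝ} (hp0 : 0 ≤ p)
    (hp : p < 2) :
    ∃ C : ℝ, 0 ≤ C ∧ ∀ z : ℂ, IntegrableOn (fun y => ‖z - cx y‖ ^ (-p)) S ∧
      ∫ y in S, ‖z - cx y‖ ^ (-p) ≤ C := by
  set g : ℂ → ℝ := (Metric.ball (0 : ℂ) 1).indicator fun w => ‖w‖ ^ (-p) with hg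
  have hgi : Integrable g := integrable_rpow_neg_norm_near_zero hp
  have hg0 : ∀ w, 0 ≤ g w := fun w => Set.indicator_nonneg (fun _ _ => by positivity) w
  have hle : ∀ w : ℂ, ‖w‖ ^ (-p) ≤ g w + 1 := by
    intro w
    by_cases hw : ‖w‖ < 1
    · have : g w = ‖w‖ ^ (-p) := by simp [hg, hw]
      linarith
    · have := Real.rpow_le_one_of_one_le_of_nonpos (not_lt.mp hw) (neg_nonpos.2 hp0)
      linarith [hg0 w]
  refine ⟨(∫ w, g w) + volume.real S, add_nonneg (integral_nonneg hg0) measureReal_nonneg, fun z => ?_⟩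
  have hz : Integrable (fun w => g (z - w)) := hgi.comp_sub_left z
  have hzi : Integrable (fun y => g (z - cx y)) :=
    measurePreserving_cx.integrable_comp_of_integrable hz
  have hval : ∫ y, g (z - cx y) = ∫ w, g w := by
    have he : MeasurableEmbedding cx :=
      Complex.equivRealProdCLM.symm.toHomeomorph.measurableEmbedding
    rw [measurePreserving_cx.integral_comp he (fun w => g (z - w)), integral_sub_left_eq_self]
  have hdom : IntegrableOn (fun y => g (z - cx y) + 1) S :=
    hzi.integrableOn.add (integrableOn_const hS)
  have hm : Measurable (fun y => ‖z - cx y‖ ^ (-p)) :=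
    ((measurable_const.sub measurable_cx).norm).pow_const _
  have hint : IntegrableOn (fun y => ‖z - cx y‖ ^ (-p)) S := by
    refine hdom.mono' hm.aestronglyMeasurable (Eventually.of_forall fun y => ?_)
    rw [Real.norm_of_nonneg (by positivity)]
    exact hle _
  refine ⟨hint, ?_⟩
  calc ∫ y in S, ‖z - cx y‖ ^ (-p) ≤ ∫ y in S, (g (z - cx y) + 1) :=
        integral_mono hint hdom fun y => hle _
    _ = (∫ y in S, g (z - cx y)) + volume.real S := by
        rw [integral_add hzi.integrableOn (integrableOn_const hS)]; simp
    _ ≤ (∫ w, g w) + volume.real S := by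
        rw [← hval]
        gcongr
        · exact Eventually.of_forall fun y => hg0 _
        · exact Measure.restrict_le_self

lemma mul_rpow_le_add_rpow {a b r : ℝ} (ha : 0 < a) (hb : 0 < b) (hr : 0 ≤ r) :
    a ^ (-r) * b⁻¹ ≤ a ^ (-(1 + r)) + b ^ (-(1 + r)) := by
  have e : ∀ c : ℝ, 0 < c → c ^ (-(1 + r)) = c ^ (-r) * c⁻¹ := fun c hc => by
    rw [← Real.rpow_neg_one c, ← Real.rpow_add hc]; ring_nf
  rw [e a ha, e b hb]
  rcases le_total a b with h | h
  · have : a ^ (-r) * b⁻¹ ≤ a ^ (-r) * a⁻¹ := by gcongr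
    have : 0 ≤ b ^ (-r) * b⁻¹ := by positivity
    linarith
  · have : a ^ (-r) * b⁻¹ ≤ b ^ (-r) * b⁻¹ := by
      gcongr ?_ * _
      exact Real.rpow_le_rpow_of_nonpos hb h (neg_nonpos.2 hr)
    have : 0 ≤ a ^ (-r) * a⁻¹ := by positivity
    linarith

lemma norm_inv_sub_inv_le_rpow {a b : ℂ} (ha : a ≠ 0) (hb : b ≠ 0) {r : ℝ} (hr : 0 ≤ r)
    (hr1 : r ≤ 1) :
    ‖a⁻¹ - b⁻¹‖ ≤ 2 * ‖a - b‖ ^ r * (‖a‖ ^ (-(1 + r)) + ‖b‖ ^ (-(1 + r))) := by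
  have ha' : 0 < ‖a‖ := norm_pos_iff.2 ha
  have hb' : 0 < ‖b‖ := norm_pos_iff.2 hb
  have h1 : ‖a⁻¹ - b⁻¹‖ = ‖a - b‖ * (‖a‖⁻¹ * ‖b‖⁻¹) := by
    rw [inv_sub_inv ha hb, norm_div, norm_mul, norm_sub_rev, div_eq_mul_inv, mul_inv]
  rcases eq_or_ne (‖a - b‖) 0 with h0 | h0
  · rw [h1, h0, zero_mul]; positivity
  have hd : 0 < ‖a - b‖ := lt_of_le_of_ne (norm_nonneg _) h0.symm
  have h2 : ‖a - b‖ = ‖a - b‖ ^ r * ‖a - b‖ ^ (1 - r) := by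
    rw [← Real.rpow_add hd]; simp
  have h3 : ‖a - b‖ ^ (1 - r) ≤ ‖a‖ ^ (1 - r) + ‖b‖ ^ (1 - r) :=
    (Real.rpow_le_rpow hd.le (norm_sub_le a b) (by linarith)).trans
      (Real.rpow_add_le_add_rpow ha'.le hb'.le (by linarith) (by linarith))
  have e : ∀ c : ℝ, 0 < c → c ^ (1 - r) * c⁻¹ = c ^ (-r) := fun c hc => by
    rw [← Real.rpow_neg_one c, ← Real.rpow_add hc]; ring_nf
  have h4 : ‖a - b‖ ^ (1 - r) * (‖a‖⁻¹ * ‖b‖⁻¹) ≤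
      2 * (‖a‖ ^ (-(1 + r)) + ‖b‖ ^ (-(1 + r))) := by
    calc _ ≤ (‖a‖ ^ (1 - r) + ‖b‖ ^ (1 - r)) * (‖a‖⁻¹ * ‖b‖⁻¹) := by gcongr
      _ = ‖a‖ ^ (-r) * ‖b‖⁻¹ + ‖b‖ ^ (-r) * ‖a‖⁻¹ := by
          rw [← e _ ha', ← e _ hb']; ring
      _ ≤ _ := by
          linarith [mul_rpow_le_add_rpow ha' hb' hr, mul_rpow_le_add_rpow hb' ha' hr]
  calc ‖a⁻¹ - b⁻¹‖ = ‖a - b‖ ^ r * (‖a - b‖ ^ (1 - r) * (‖a‖⁻¹ * ‖b‖⁻¹)) := by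
        rw [h1, ← mul_assoc (‖a - b‖ ^ r), ← h2]
    _ ≤ ‖a - b‖ ^ r * (2 * (‖a‖ ^ (-(1 + r)) + ‖b‖ ^ (-(1 + r)))) := by gcongr
    _ = _ := by ring

lemma abs_log_norm_one_add_sub_re_le {w : ℂ} (hw : 1 + w ≠ 0) :
    |Real.log ‖1 + w‖ - w.re| ≤
      4 * ‖w‖ ^ (3 / 2 : ℝ) * (1 + ‖1 + w‖ ^ (-(3 / 2) : ℝ)) := by
  have hb : 0 < ‖1 + w‖ := norm_pos_iff.2 hw
  have hB : 0 ≤ ‖1 + w‖ ^ (-(3 / 2) : ℝ) := by positivity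
  have hX : 0 ≤ ‖w‖ ^ (3 / 2 : ℝ) := by positivity
  rcases lt_or_ge ‖w‖ (1 / 2) with h | h
  · have h1 := Complex.norm_log_one_add_sub_self_le (z := w) (by linarith)
    have h2 : |Real.log ‖1 + w‖ - w.re| ≤ ‖Complex.log (1 + w) - w‖ := by
      have := Complex.abs_re_le_norm (Complex.log (1 + w) - w)
      rwa [Complex.sub_re, Complex.log_re] at this
    have h3 : ‖w‖ ^ 2 ≤ ‖w‖ ^ (3 / 2 : ℝ) := by
      rcases eq_or_ne ‖w‖ 0 with h0 | h0
      · rw [h0]; norm_num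
      rw [← Real.rpow_natCast]
      exact Real.rpow_le_rpow_of_exponent_ge (lt_of_le_of_ne (norm_nonneg _) h0.symm)
        (by linarith) (by norm_num)
    have h4 : (1 - ‖w‖)⁻¹ ≤ 2 := by
      rw [inv_le_comm₀ (by linarith) (by norm_num)]; linarith
    have h5 : ‖w‖ ^ 2 * (1 - ‖w‖)⁻¹ / 2 ≤ ‖w‖ ^ 2 := by
      nlinarith [sq_nonneg ‖w‖]
    nlinarith [mul_nonneg hX hB]
  · have hw0 : 0 < ‖w‖ := by linarith
    have h1 : ‖w‖ ≤ 2 * ‖w‖ ^ (3 / 2 : ℝ) := by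
      have e : ‖w‖ ^ (3 / 2 : ℝ) = ‖w‖ * ‖w‖ ^ (1 / 2 : ℝ) := by
        nth_rewrite 2 [← Real.rpow_one ‖w‖]
        rw [← Real.rpow_add hw0]; norm_num
      have : (1 / 2 : ℝ) ≤ ‖w‖ ^ (1 / 2 : ℝ) := by
        rw [← Real.sqrt_eq_rpow]
        exact Real.le_sqrt_of_sq_le (by linarith)
      rw [e]; nlinarith
    have h2 : Real.log ‖1 + w‖ ≤ ‖w‖ := by
      have := Real.log_le_sub_one_of_pos hb
      have := norm_add_le (1 : ℂ) w
      rw [norm_one] at this; linarith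
    have h3 : -Real.log ‖1 + w‖ ≤ ‖1 + w‖ ^ (-(3 / 2) : ℝ) := by
      have i1 := Real.one_sub_inv_le_log_of_pos hb
      have i2 : ‖1 + w‖⁻¹ ≤ 1 + ‖1 + w‖ ^ (-(3 / 2) : ℝ) := by
        rcases le_total 1 ‖1 + w‖ with hh | hh
        · linarith [inv_le_one_of_one_le₀ hh]
        · rw [← Real.rpow_neg_one]
          linarith [Real.rpow_le_rpow_of_exponent_ge hb hh
            (show (-(3 / 2) : ℝ) ≤ -1 by norm_num)]
      linarith
    have h4 := abs_le.1 (Complex.abs_re_le_norm w)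
    have h5 : (1 / 4 : ℝ) ≤ ‖w‖ ^ (3 / 2 : ℝ) := by linarith
    rw [abs_le]
    constructor <;> nlinarith [mul_nonneg (sub_nonneg.2 h5) hB, mul_nonneg hX hB]

lemma abs_log_norm_add_sub_le {z h : ℂ} (hz : z ≠ 0) (hzh : z + h ≠ 0) :
    |Real.log ‖z + h‖ - Real.log ‖z‖ - (h * z⁻¹).re| ≤
      4 * ‖h‖ ^ (3 / 2 : ℝ) * (‖z‖ ^ (-(3 / 2) : ℝ) + ‖z + h‖ ^ (-(3 / 2) : ℝ)) := by
  have hz' : 0 < ‖z‖ := norm_pos_iff.2 hz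
  have e : z + h = z * (1 + h * z⁻¹) := by field_simp
  have hw : 1 + h * z⁻¹ ≠ 0 := fun h0 => hzh (by rw [e, h0, mul_zero])
  have hw' : 0 < ‖1 + h * z⁻¹‖ := norm_pos_iff.2 hw
  have := abs_log_norm_one_add_sub_re_le hw
  rw [e, norm_mul, Real.log_mul hz'.ne' hw'.ne', add_sub_cancel_left]
  refine this.trans (le_of_eq ?_)
  rw [norm_mul, norm_inv, Real.mul_rpow (norm_nonneg _) (by positivity),
    Real.mul_rpow (norm_nonneg _) (by positivity), Real.inv_rpow hz'.le, ← Real.rpow_neg hz'.le]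
  ring

/-- The logarithmic potential of a planar set. -/
def logPot (S : Set (ℝ × ℝ)) (z : ℂ) : ℝ := ∫ y in S, Real.log ‖z - cx y‖

/-- The Cauchy transform of a planar set. -/
def cauchyPot (S : Set (ℝ × ℝ)) (z : ℂ) : ℂ := ∫ y in S, (z - cx y)⁻¹

lemma integrableOn_inv_norm {S : Set (ℝ × ℝ)} (hS : volume S ≠ ⊤) (z : ℂ) :
    IntegrableOn (fun y => ‖z - cx y‖⁻¹) S := by
  obtain ⟨C, -, hC⟩ := exists_riesz_bound hS zero_le_one one_lt_two
  simpa [Real.rpow_neg_one] using (hC z).1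

lemma integrableOn_cauchy {S : Set (ℝ × ℝ)} (hS : volume S ≠ ⊤) (z : ℂ) :
    IntegrableOn (fun y => (z - cx y)⁻¹) S := by
  refine (integrableOn_inv_norm hS z).mono'
    (measurable_const.sub measurable_cx).inv.aestronglyMeasurable
    (Eventually.of_forall fun y => ?_)
  rw [norm_inv]

lemma integrableOn_log {S : Set (ℝ × ℝ)} (hSm : MeasurableSet S) (hS : Bornology.IsBounded S)
    (z : ℂ) : IntegrableOn (fun y => Real.log ‖z - cx y‖) S := by
  have hfin : volume S ≠ ⊤ := hS.measure_lt_top.ne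
  obtain ⟨R, hR⟩ := hS.exists_norm_le
  have hb : IntegrableOn (fun y => (‖z‖ + ‖cx‖ * R) + ‖z - cx y‖⁻¹) S :=
    (integrableOn_const hfin).add (integrableOn_inv_norm hfin z)
  refine hb.mono' (measurable_const.sub measurable_cx).norm.log.aestronglyMeasurable ?_
  rw [ae_restrict_iff' hSm]
  filter_upwards [ae_ne_cx z] with y hy hyS
  have hp : 0 < ‖z - cx y‖ := norm_pos_iff.2 hy
  have h1 := Real.log_le_sub_one_of_pos hp
  have h2 := Real.one_sub_inv_le_log_of_pos hp
  have h3 : ‖z - cx y‖ ≤ ‖z‖ + ‖cx‖ * R :=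
    (norm_sub_le _ _).trans (by gcongr; exact (cx.le_opNorm y).trans (by gcongr; exact hR y hyS))
  have h4 : 0 ≤ ‖z - cx y‖⁻¹ := by positivity
  rw [Real.norm_eq_abs, abs_le]
  constructor <;> linarith

/-- The Cauchy transform of a set of finite measure is Hölder continuous of every exponent
less than one. -/
lemma cauchyPot_holder {S : Set (ℝ × ℝ)} (hS : volume S ≠ ⊤) {r : ℝ} (hr : 0 ≤ r)
    (hr1 : r < 1) :
    ∃ C : ℝ, 0 ≤ C ∧ ∀ z z' : ℂ, ‖cauchyPot S z - cauchyPot S z'‖ ≤ C * ‖z - z'‖ ^ r := by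
  obtain ⟨C, hC0, hC⟩ := exists_riesz_bound hS (p := 1 + r) (by linarith) (by linarith)
  refine ⟨4 * C, by positivity, fun z z' => ?_⟩
  rw [cauchyPot, cauchyPot, ← integral_sub (integrableOn_cauchy hS z) (integrableOn_cauchy hS z')]
  have hi := ((hC z).1.add (hC z').1).const_mul (2 * ‖z - z'‖ ^ r)
  calc _ ≤ ∫ y in S, 2 * ‖z - z'‖ ^ r *
        (‖z - cx y‖ ^ (-(1 + r)) + ‖z' - cx y‖ ^ (-(1 + r))) := by
        refine norm_integral_le_of_norm_le hi (ae_restrict_of_ae ?_)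
        filter_upwards [ae_ne_cx z, ae_ne_cx z'] with y h1 h2
        have := norm_inv_sub_inv_le_rpow h1 h2 hr hr1.le
        rwa [sub_sub_sub_cancel_right] at this
    _ = 2 * ‖z - z'‖ ^ r * ((∫ y in S, ‖z - cx y‖ ^ (-(1 + r))) +
          ∫ y in S, ‖z' - cx y‖ ^ (-(1 + r))) := by
        rw [integral_const_mul, integral_add (hC z).1 (hC z').1]
    _ ≤ 2 * ‖z - z'‖ ^ r * (C + C) := by gcongr; exacts [(hC z).2, (hC z').2]
    _ = _ := by ring

lemma continuous_cauchyPot {S : Set (ℝ × ℝ)} (hS : volume S ≠ ⊤) : Continuous (cauchyPot S) := by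
  obtain ⟨C, hC0, hC⟩ := cauchyPot_holder hS (r := 1 / 2) (by norm_num) (by norm_num)
  rw [continuous_iff_continuousAt]
  intro z
  rw [ContinuousAt, tendsto_iff_norm_sub_tendsto_zero]
  refine squeeze_zero (fun _ => norm_nonneg _) (fun w => hC w z) ?_
  have h : Continuous fun w : ℂ => C * ‖w - z‖ ^ (1 / 2 : ℝ) :=
    continuous_const.mul ((continuous_id.sub continuous_const).norm.rpow_const
      fun _ => Or.inr (by norm_num))
  simpa using h.tendsto z

/-- The gradient of the logarithmic potential is given by the Cauchy transform. -/
lemma hasFDerivAt_logPot {S : Set (ℝ × ℝ)} (hSm : MeasurableSet S) (hS : Bornology.IsBounded S)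
    (z : ℂ) :
    HasFDerivAt (logPot S)
      (Complex.reCLM ∘L (ContinuousLinearMap.mul ℝ ℂ).flip (cauchyPot S z)) z := by
  have hfin : volume S ≠ ⊤ := hS.measure_lt_top.ne
  obtain ⟨C, hC0, hC⟩ := exists_riesz_bound hfin (p := 3 / 2) (by norm_num) (by norm_num)
  have key : ∀ h : ℂ, ‖logPot S (z + h) - logPot S z - (h * cauchyPot S z).re‖ ≤
      8 * C * ‖h‖ ^ (3 / 2 : ℝ) := by
    intro h
    have i1 := integrableOn_log hSm hS (z + h)
    have i2 := integrableOn_log hSm hS z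
    have i3 : IntegrableOn (fun y => (h * (z - cx y)⁻¹).re) S :=
      ((integrableOn_cauchy hfin z).const_mul h).re
    have e : (h * cauchyPot S z).re = ∫ y in S, (h * (z - cx y)⁻¹).re := by
      rw [cauchyPot, ← integral_const_mul]
      exact (integral_re ((integrableOn_cauchy hfin z).const_mul h)).symm
    have hi := ((hC z).1.add (hC (z + h)).1).const_mul (4 * ‖h‖ ^ (3 / 2 : ℝ))
    rw [e, logPot, logPot, ← integral_sub i1 i2, 
      ← integral_sub (f := fun y => Real.log ‖z + h - cx y‖ - Real.log ‖z - cx y‖) (i1.sub i2) i3]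
    calc _ ≤ ∫ y in S, 4 * ‖h‖ ^ (3 / 2 : ℝ) *
          (‖z - cx y‖ ^ (-(3 / 2) : ℝ) + ‖z + h - cx y‖ ^ (-(3 / 2) : ℝ)) := by
          refine norm_integral_le_of_norm_le hi (ae_restrict_of_ae ?_)
          filter_upwards [ae_ne_cx z, ae_ne_cx (z + h)] with y h1 h2
          have e2 : z + h - cx y = z - cx y + h := by ring
          rw [e2] at h2 ⊢
          exact abs_log_norm_add_sub_le h1 h2
      _ = 4 * ‖h‖ ^ (3 / 2 : ℝ) * ((∫ y in S, ‖z - cx y‖ ^ (-(3 / 2) : ℝ)) +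
            ∫ y in S, ‖z + h - cx y‖ ^ (-(3 / 2) : ℝ)) := by
          rw [integral_const_mul, integral_add (hC z).1 (hC (z + h)).1]
      _ ≤ 4 * ‖h‖ ^ (3 / 2 : ℝ) * (C + C) := by gcongr; exacts [(hC z).2, (hC _).2]
      _ = _ := by ring
  rw [hasFDerivAt_iff_isLittleO_nhds_zero]
  have hO : (fun h : ℂ => logPot S (z + h) - logPot S z -
      (Complex.reCLM ∘L (ContinuousLinearMap.mul ℝ ℂ).flip (cauchyPot S z)) h) =O[𝓝 0]
      fun h => ‖h‖ ^ (3 / 2 : ℝ) := by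
    refine Asymptotics.IsBigO.of_bound (8 * C) (Eventually.of_forall fun h => ?_)
    rw [Real.norm_of_nonneg (by positivity : 0 ≤ ‖h‖ ^ (3 / 2 : ℝ))]
    have e : (Complex.reCLM ∘L (ContinuousLinearMap.mul ℝ ℂ).flip (cauchyPot S z)) h =
        (h * cauchyPot S z).re := rfl
    rw [e]
    exact key h
  refine hO.trans_isLittleO ?_
  rw [Asymptotics.isLittleO_iff]
  intro c hc
  filter_upwards [Metric.ball_mem_nhds (0 : ℂ) (pow_pos hc 2)] with h hh
  rw [mem_ball_zero_iff] at hh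
  rw [Real.norm_of_nonneg (by positivity)]
  rcases eq_or_ne ‖h‖ 0 with h0 | h0
  · rw [h0]; norm_num
  have hp : 0 < ‖h‖ := lt_of_le_of_ne (norm_nonneg _) h0.symm
  have e : ‖h‖ ^ (3 / 2 : ℝ) = √‖h‖ * ‖h‖ := by
    rw [Real.sqrt_eq_rpow]
    nth_rewrite 3 [← Real.rpow_one ‖h‖]
    rw [← Real.rpow_add hp]; norm_num
  rw [e]
  gcongr
  exact (Real.sqrt_le_left hc.le).2 hh.le

open scoped ComplexConjugate in
/-- The stream function of an odd-symmetric vortex pair with upper patch `S`. -/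
def stream (S : Set (ℝ × ℝ)) (x : ℝ × ℝ) : ℝ :=
  (1 / (2 * π)) * (logPot S (conj (cx x)) - logPot S (cx x))

open scoped ComplexConjugate in
/-- The horizontal partial derivative of `stream S`. -/
def stream₁ (S : Set (ℝ × ℝ)) (x : ℝ × ℝ) : ℝ :=
  (1 / (2 * π)) * ((cauchyPot S (conj (cx x))).re - (cauchyPot S (cx x)).re)

open scoped ComplexConjugate in
/-- The vertical partial derivative of `stream S`. -/
def stream₂ (S : Set (ℝ × ℝ)) (x : ℝ × ℝ) : ℝ :=
  (1 / (2 * π)) * ((cauchyPot S (conj (cx x))).im + (cauchyPot S (cx x)).im)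

lemma stream_of_snd_eq_zero (S : Set (ℝ × ℝ)) (c : ℝ) : stream S (c, 0) = 0 := by
  have : (starRingEnd ℂ) (cx (c, 0)) = cx (c, 0) := by apply Complex.ext <;> simp
  simp [stream, this]

lemma hasFDerivAt_stream {S : Set (ℝ × ℝ)} (hSm : MeasurableSet S) (hS : Bornology.IsBounded S)
    (x : ℝ × ℝ) :
    HasFDerivAt (stream S) (stream₁ S x • ContinuousLinearMap.fst ℝ ℝ ℝ +
      stream₂ S x • ContinuousLinearMap.snd ℝ ℝ ℝ) x := by
  have h1 := (hasFDerivAt_logPot hSm hS (cx x)).comp x cx.hasFDerivAt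
  have h2 := (hasFDerivAt_logPot hSm hS (Complex.conjCLE.toContinuousLinearMap (cx x))).comp x
    (Complex.conjCLE.toContinuousLinearMap ∘L cx).hasFDerivAt
  have h3 := (h2.sub h1).const_mul (1 / (2 * π))
  refine h3.congr_fderiv ?_
  ext
  all_goals
    simp [stream₁, stream₂]
  try ring

lemma stream_holder {S : Set (ℝ × ℝ)} (hS : volume S ≠ ⊤) {r : ℝ} (hr : 0 ≤ r) (hr1 : r < 1) :
    ∃ C : ℝ, 0 ≤ C ∧ ∀ x x' : ℝ × ℝ, |stream₁ S x - stream₁ S x'| ≤ C * ‖x - x'‖ ^ r ∧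
      |stream₂ S x - stream₂ S x'| ≤ C * ‖x - x'‖ ^ r := by
  obtain ⟨C, hC0, hC⟩ := cauchyPot_holder hS hr hr1
  refine ⟨(1 / (2 * π)) * (2 * (C * ‖cx‖ ^ r)), by positivity, fun x x' => ?_⟩
  have h0 : ‖cx x - cx x'‖ ^ r ≤ ‖cx‖ ^ r * ‖x - x'‖ ^ r := by
    rw [← map_sub, ← Real.mul_rpow (norm_nonneg _) (norm_nonneg _)]
    gcongr
    exact cx.le_opNorm _
  have h1 : ‖cauchyPot S (cx x) - cauchyPot S (cx x')‖ ≤ C * (‖cx‖ ^ r * ‖x - x'‖ ^ r) :=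
    (hC _ _).trans (by gcongr)
  have h2 : ‖cauchyPot S ((starRingEnd ℂ) (cx x)) - cauchyPot S ((starRingEnd ℂ) (cx x'))‖ ≤
      C * (‖cx‖ ^ r * ‖x - x'‖ ^ r) := by
    refine (hC _ _).trans ?_
    rw [← map_sub, RCLike.norm_conj]
    gcongr
  have hp : 0 < 1 / (2 * π) := by positivity
  have r1 := (Complex.abs_re_le_norm _).trans h1
  have r2 := (Complex.abs_re_le_norm _).trans h2
  have i1 := (Complex.abs_im_le_norm _).trans h1
  have i2 := (Complex.abs_im_le_norm _).trans h2
  simp only [Complex.sub_re, Complex.sub_im, abs_le] at r1 r2 i1 i2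
  constructor
  · rw [stream₁, stream₁, ← mul_sub, abs_mul, abs_of_pos hp, mul_assoc]
    gcongr
    rw [abs_le]
    constructor <;> linarith
  · rw [stream₂, stream₂, ← mul_sub, abs_mul, abs_of_pos hp, mul_assoc]
    gcongr
    rw [abs_le]
    constructor <;> linarith

lemma continuous_stream₁ {S : Set (ℝ × ℝ)} (hS : volume S ≠ ⊤) : Continuous (stream₁ S) := by
  have h := continuous_cauchyPot hS
  have h2 := cx.continuous
  unfold stream₁
  fun_prop

lemma continuous_stream₂ {S : Set (ℝ × ℝ)} (hS : volume S ≠ ⊤) : Continuous (stream₂ S) := by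
  have h := continuous_cauchyPot hS
  have h2 := cx.continuous
  unfold stream₂
  fun_prop

lemma cauchyPot_re {S : Set (ℝ × ℝ)} (hS : volume S ≠ ⊤) (z : ℂ) :
    (cauchyPot S z).re = ∫ y in S, (z.re - y.1) / ((z.re - y.1) ^ 2 + (z.im - y.2) ^ 2) := by
  rw [cauchyPot]
  refine (integral_re (integrableOn_cauchy hS z)).symm.trans ?_
  congr 1 with y
  simp [Complex.normSq_apply, sq]

lemma cauchyPot_im {S : Set (ℝ × ℝ)} (hS : volume S ≠ ⊤) (z : ℂ) :
    (cauchyPot S z).im = ∫ y in S, (y.2 - z.im) / ((z.re - y.1) ^ 2 + (z.im - y.2) ^ 2) := by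
  rw [cauchyPot]
  refine (integral_im (integrableOn_cauchy hS z)).symm.trans ?_
  congr 1 with y
  simp [Complex.normSq_apply, sq]

lemma integrableOn_cauchy_re {S : Set (ℝ × ℝ)} (hS : volume S ≠ ⊤) (z : ℂ) :
    IntegrableOn (fun y => (z.re - y.1) / ((z.re - y.1) ^ 2 + (z.im - y.2) ^ 2)) S := by
  refine (integrableOn_cauchy hS z).re.congr (ae_of_all _ fun y => ?_)
  simp [Complex.normSq_apply, sq]

lemma integrableOn_cauchy_im {S : Set (ℝ × ℝ)} (hS : volume S ≠ ⊤) (z : ℂ) :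
    IntegrableOn (fun y => (y.2 - z.im) / ((z.re - y.1) ^ 2 + (z.im - y.2) ^ 2)) S := by
  refine (integrableOn_cauchy hS z).im.congr (ae_of_all _ fun y => ?_)
  simp [Complex.normSq_apply, sq]

lemma G_eq_log_sub_log {x y : ℝ × ℝ} (hx : 0 < x.2) (hy : 0 < y.2) (hxy : cx x - cx y ≠ 0) :
    G x y = (1 / (2 * π)) *
      (Real.log ‖(starRingEnd ℂ) (cx x) - cx y‖ - Real.log ‖cx x - cx y‖) := by
  have h1 : ‖cx x - cx y‖ ^ 2 = (x.1 - y.1) ^ 2 + (x.2 - y.2) ^ 2 := by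
    rw [← map_sub, norm_cx_sq]; simp
  have h2 : ‖(starRingEnd ℂ) (cx x) - cx y‖ ^ 2 = (x.1 - y.1) ^ 2 + (x.2 + y.2) ^ 2 := by
    rw [Complex.sq_norm, Complex.normSq_apply]; simp; ring
  have p1 : 0 < ‖cx x - cx y‖ := norm_pos_iff.2 hxy
  have p2 : 0 < ‖(starRingEnd ℂ) (cx x) - cx y‖ := by
    have : 0 < (x.1 - y.1) ^ 2 + (x.2 + y.2) ^ 2 := by positivity
    rw [← h2] at this
    exact norm_pos_iff.2 fun h0 => this.ne' (by rw [h0]; simp)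
  have h3 : 1 + 4 * x.2 * y.2 / ((x.1 - y.1) ^ 2 + (x.2 - y.2) ^ 2) =
      ‖(starRingEnd ℂ) (cx x) - cx y‖ ^ 2 / ‖cx x - cx y‖ ^ 2 := by
    have : ‖cx x - cx y‖ ^ 2 ≠ 0 := by positivity
    rw [← h1]
    field_simp
    rw [h1, h2]; ring
  rw [G, h3, Real.log_div (by positivity) (by positivity), Real.log_pow, Real.log_pow]
  push_cast
  field_simp
  ring

lemma measurableSet_H : MeasurableSet H := measurableSet_lt measurable_const measurable_snd

lemma Gpot_eq_stream {ω : ℝ × ℝ → ℝ} {S : Set (ℝ × ℝ)} (hSm : MeasurableSet S)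
    (hSb : Bornology.IsBounded S) (hSH : S ⊆ H)
    (hω : ∀ x ∈ H, ω x = S.indicator (fun _ => (1 : ℝ)) x) {x : ℝ × ℝ} (hx : x ∈ H) :
    Gpot ω x = stream S x := by
  have e1 : Gpot ω x = ∫ y in H, S.indicator (G x) y := by
    refine setIntegral_congr_fun measurableSet_H fun y hy => ?_
    simp only [hω y hy, Set.indicator]
    split_ifs <;> simp
  rw [e1, setIntegral_indicator hSm, Set.inter_eq_right.2 hSH, stream, logPot, logPot,
    ← integral_sub (integrableOn_log hSm hSb _) (integrableOn_log hSm hSb _),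
    ← integral_const_mul]
  refine setIntegral_congr_ae hSm ?_
  filter_upwards [ae_ne_cx (cx x)] with y hy hyS
  exact G_eq_log_sub_log hx (hSH hyS) hy

/-- Reflection across the vertical line `y₁ = c`. -/
def reflect (c : ℝ) : ℝ × ℝ ≃ᵐ ℝ × ℝ :=
  (MeasurableEquiv.subLeft (2 * c)).prodCongr (MeasurableEquiv.refl ℝ)

lemma reflect_apply (c : ℝ) (y : ℝ × ℝ) : reflect c y = (2 * c - y.1, y.2) := rfl

lemma measurePreserving_reflect (c : ℝ) : MeasurePreserving (reflect c) volume volume :=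
  (Measure.measurePreserving_sub_left volume (2 * c)).prod (MeasurePreserving.id volume)

lemma integral_reflect (c : ℝ) (f : ℝ × ℝ → ℝ) : ∫ y, f (reflect c y) = ∫ y, f y :=
  (measurePreserving_reflect c).integral_comp' f

lemma integrable_reflect {c : ℝ} {f : ℝ × ℝ → ℝ} (hf : Integrable f) :
    Integrable fun y => f (reflect c y) :=
  (measurePreserving_reflect c).integrable_comp_of_integrable hf

lemma ae_fst_ne (c : ℝ) : ∀ᵐ y : ℝ × ℝ, y.1 ≠ c :=
  Measure.quasiMeasurePreserving_fst.ae (μa := volume) (μb := (volume : Measure ℝ))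
    (p := fun t => t ≠ c) (by simp [ae_iff])

/-- A Steiner symmetric set meets the half-plane `y₁ < c` no less than its reflection does. -/
lemma SteinerSet.mem_of_reflect_mem {S : Set (ℝ × ℝ)} (hst : SteinerSet S) {c : ℝ} (hc : 0 ≤ c)
    {y : ℝ × ℝ} (hy2 : 0 < y.2) (hyc : y.1 ≤ c) (h : reflect c y ∈ S) : y ∈ S := by
  rw [reflect_apply] at h
  have h1 := hst.2 y.2 hy2 |y.1| (2 * c - y.1) (abs_nonneg _)
    (abs_le.2 ⟨by linarith, by linarith⟩) h
  rcases abs_cases y.1 with ⟨e, -⟩ | ⟨e, -⟩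
  · rwa [e] at h1
  · rw [e] at h1
    exact (hst.1 y.1 y.2 hy2).2 h1

lemma SteinerSet.reflect_zero_mem_iff {S : Set (ℝ × ℝ)} (hst : SteinerSet S) (hSH : S ⊆ H)
    (y : ℝ × ℝ) : reflect 0 y ∈ S ↔ y ∈ S := by
  have e : reflect 0 y = (-y.1, y.2) := by rw [reflect_apply]; simp
  rw [e]
  constructor
  · intro hy
    have h2 : 0 < ((-y.1, y.2) : ℝ × ℝ).2 := hSH hy
    exact (hst.1 y.1 y.2 h2).2 hy
  · exact fun hy => (hst.1 y.1 y.2 (hSH hy)).1 hy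

lemma SteinerSet.integral_fst {S : Set (ℝ × ℝ)} (hst : SteinerSet S) (hSm : MeasurableSet S)
    (hSH : S ⊆ H) : ∫ y in S, y.1 = 0 := by
  rw [← integral_indicator hSm]
  have h := integral_reflect 0 (S.indicator fun y => y.1)
  have e : (fun y => S.indicator (fun y : ℝ × ℝ => y.1) (reflect 0 y)) =
      fun y => -(S.indicator (fun y : ℝ × ℝ => y.1) y) := by
    ext y
    have hiff : reflect 0 y ∈ S ↔ y ∈ S := hst.reflect_zero_mem_iff hSH y
    by_cases hy : y ∈ S
    · rw [indicator_of_mem hy, indicator_of_mem (hiff.2 hy), reflect_apply]; simp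
    · rw [indicator_of_notMem hy, indicator_of_notMem (fun h => hy (hiff.1 h))]; simp
  rw [e, integral_neg] at h
  linarith

/-- A kernel that is odd in the horizontal variable and negative on the right has a negative
integral over a Steiner symmetric set, when centred to the right of the axis of symmetry. -/
lemma SteinerSet.integral_neg_of_odd {S : Set (ℝ × ℝ)} (hst : SteinerSet S)
    (hSm : MeasurableSet S) (hSb : Bornology.IsBounded S) (hSH : S ⊆ H) (hS0 : 0 < volume.real S)
    {f : ℝ → ℝ → ℝ} (hodd : ∀ d s, f (-d) s = -f d s) (hneg : ∀ d s, 0 < d → 0 < s → f d s < 0)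
    {c : ℝ} (hc : 0 < c) (hfi : IntegrableOn (fun y : ℝ × ℝ => f (c - y.1) y.2) S) :
    ∫ y in S, f (c - y.1) y.2 < 0 := by
  have hfin : volume S ≠ ⊤ := hSb.measure_lt_top.ne
  set φ : ℝ × ℝ → ℝ := S.indicator fun y => f (c - y.1) y.2 with hφ
  have hφi : Integrable φ := (integrable_indicator_iff hSm).2 hfi
  have hφr : ∀ y, φ (reflect c y) = -((reflect c ⁻¹' S).indicator (fun y => f (c - y.1) y.2) y) := by
    intro y
    by_cases hy : reflect c y ∈ S
    · rw [indicator_of_mem (show y ∈ reflect c ⁻¹' S from hy), hφ, indicator_of_mem hy, ← hodd,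
        reflect_apply]
      ring_nf
    · rw [indicator_of_notMem (show y ∉ reflect c ⁻¹' S from hy), hφ, indicator_of_notMem hy,
        neg_zero]
  by_contra! hcon
  rw [← integral_indicator hSm, ← hφ] at hcon
  have hsum : ∀ y, 0 ≤ -(φ y + φ (reflect c y)) ∧
      (y.1 ≠ c → φ y + φ (reflect c y) = 0 → (y ∈ S ↔ reflect c y ∈ S)) := by
    intro y
    rw [hφr]
    by_cases h1 : y ∈ S <;> by_cases h2 : reflect c y ∈ S
    · rw [hφ, indicator_of_mem h1, indicator_of_mem (show y ∈ reflect c ⁻¹' S from h2)]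
      simp [h1, h2]
    · have hy2 : 0 < y.2 := hSH h1
      have hlt : y.1 ≤ c := by
        by_contra! hgt
        refine h2 (hst.mem_of_reflect_mem hc.le (y := reflect c y) hy2 ?_ ?_)
        · simp only [reflect_apply]; linarith
        · simpa [reflect_apply] using h1
      rw [hφ, indicator_of_mem h1, indicator_of_notMem (show y ∉ reflect c ⁻¹' S from h2)]
      rcases hlt.eq_or_lt with he | hlt
      · have h0 := hodd 0 y.2
        rw [neg_zero] at h0
        have h0 : f 0 y.2 = 0 := by linarith
        simp [he, h0]
      · have := hneg (c - y.1) y.2 (by linarith) hy2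
        constructor
        · linarith
        · intro _ h; linarith
    · have hy2 : 0 < y.2 := by
        have : 0 < (reflect c y).2 := hSH h2
        exact this
      have hlt : c < y.1 := by
        by_contra! hle
        exact h1 (hst.mem_of_reflect_mem hc.le hy2 hle h2)
      rw [hφ, indicator_of_notMem h1, indicator_of_mem (show y ∈ reflect c ⁻¹' S from h2)]
      have := hneg (y.1 - c) y.2 (by linarith) hy2
      have h' := hodd (c - y.1) y.2
      rw [neg_sub] at h'
      constructor
      · linarith
      · intro _ h; linarith
    · rw [hφ, indicator_of_notMem h1, indicator_of_notMem (show y ∉ reflect c ⁻¹' S from h2)]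
      simp [h1, h2]
  have hrefl : ∫ y, φ (reflect c y) = ∫ y, φ y := integral_reflect c φ
  have hsi : Integrable fun y => -(φ y + φ (reflect c y)) :=
    (hφi.add (integrable_reflect hφi)).neg
  have hval : ∫ y, -(φ y + φ (reflect c y)) = -(2 * ∫ y, φ y) := by
    rw [integral_neg, integral_add hφi (integrable_reflect hφi), hrefl]; ring
  have hzero : ∫ y, -(φ y + φ (reflect c y)) = 0 :=
    le_antisymm (by rw [hval]; linarith) (integral_nonneg fun y => (hsum y).1)
  rw [integral_eq_zero_iff_of_nonneg (fun y => (hsum y).1) hsi] at hzero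
  set m : ℝ × ℝ → ℝ := S.indicator fun y => y.1 - c with hm
  have hmr : ∫ y, m y = -∫ y, m y := by
    rw [← integral_neg, ← integral_reflect c m]
    refine integral_congr_ae ?_
    filter_upwards [hzero, ae_fst_ne c] with y hy hyc
    have hiff := (hsum y).2 hyc (neg_eq_zero.1 hy)
    by_cases h : y ∈ S
    · rw [hm, indicator_of_mem h, indicator_of_mem (hiff.1 h), reflect_apply]; ring
    · rw [hm, indicator_of_notMem h, indicator_of_notMem (fun h' => h (hiff.2 h')), neg_zero]
  have hfst : IntegrableOn (fun y : ℝ × ℝ => y.1) S := by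
    obtain ⟨R, hR⟩ := hSb.exists_norm_le
    refine Measure.integrableOn_of_bounded (M := R) hfin measurable_fst.aestronglyMeasurable ?_
    rw [ae_restrict_iff' hSm]
    exact Eventually.of_forall fun y hy => (norm_fst_le y).trans (hR y hy)
  have hm0 : ∫ y, m y = -(c * volume.real S) := by
    rw [hm, integral_indicator hSm, integral_sub hfst (integrableOn_const hfin),
      hst.integral_fst hSm hSH]
    simp [mul_comm]
  have : 0 < c * volume.real S := by positivity
  linarith

/-- On the right half of the upper half-plane the stream function decreases strictly in the
horizontal direction. -/
lemma stream₁_neg {S : Set (ℝ × ℝ)} (hst : SteinerSet S)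
    (hSm : MeasurableSet S) (hSb : Bornology.IsBounded S) (hSH : S ⊆ H) (hS0 : 0 < volume.real S)
    {x : ℝ × ℝ} (hx1 : 0 < x.1) (hx2 : 0 < x.2) : stream₁ S x < 0 := by
  have hfin : volume S ≠ ⊤ := hSb.measure_lt_top.ne
  have i1 := integrableOn_cauchy_re hfin (starRingEnd ℂ (cx x))
  have i2 := integrableOn_cauchy_re hfin (cx x)
  have key := hst.integral_neg_of_odd hSm hSb hSH hS0
    (f := fun d s => d / (d ^ 2 + (-x.2 - s) ^ 2) - d / (d ^ 2 + (x.2 - s) ^ 2))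
    (fun d s => by simp only [neg_sq, neg_div]; ring) ?_ hx1 ?_
  · have hp : 0 < 1 / (2 * π) := by positivity
    rw [stream₁, cauchyPot_re hfin, cauchyPot_re hfin, ← integral_sub i1 i2]
    exact mul_neg_of_pos_of_neg hp (by simpa using key)
  · intro d s hd hs
    rw [sub_neg]
    apply div_lt_div_of_pos_left hd (by positivity)
    nlinarith [mul_pos hx2 hs]
  · have := i1.sub i2
    simp only [Complex.conj_re, Complex.conj_im, cx_re, cx_im] at this
    exact this

/-- The vertical velocity kernel integrated over a patch, for a point at horizontal
position `c` and height `-t`. -/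
def vertKer (S : Set (ℝ × ℝ)) (c t : ℝ) : ℝ :=
  ∫ y in S, (y.2 + t) / ((c - y.1) ^ 2 + (y.2 + t) ^ 2)

lemma integrableOn_vertKer {S : Set (ℝ × ℝ)} (hS : volume S ≠ ⊤) (c t : ℝ) :
    IntegrableOn (fun y => (y.2 + t) / ((c - y.1) ^ 2 + (y.2 + t) ^ 2)) S := by
  refine (integrableOn_cauchy_im hS ⟨c, -t⟩).congr (ae_of_all _ fun y => ?_)
  simp only
  congr 1 <;> ring

lemma cauchyPot_conj_im {S : Set (ℝ × ℝ)} (hS : volume S ≠ ⊤) (x : ℝ × ℝ) :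
    (cauchyPot S (starRingEnd ℂ (cx x))).im = vertKer S x.1 x.2 := by
  rw [cauchyPot_im hS, vertKer]
  congr 1 with y
  simp only [Complex.conj_re, Complex.conj_im, cx_re, cx_im]
  congr 1 <;> ring

lemma stream₂_axis {S : Set (ℝ × ℝ)} (hS : volume S ≠ ⊤) (c : ℝ) :
    stream₂ S (c, 0) = (1 / π) * vertKer S c 0 := by
  have : (starRingEnd ℂ) (cx (c, 0)) = cx (c, 0) := by apply Complex.ext <;> simp
  have h := cauchyPot_conj_im hS (c, 0)
  rw [this] at h
  rw [stream₂, this, h]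
  field_simp
  ring

lemma vertKer_lt {S : Set (ℝ × ℝ)} (hst : SteinerSet S)
    (hSm : MeasurableSet S) (hSb : Bornology.IsBounded S) (hSH : S ⊆ H) (hS0 : 0 < volume.real S)
    {c c' t : ℝ} (ht : 0 ≤ t) (hc : 0 ≤ c) (hcc' : c < c') : vertKer S c' t < vertKer S c t := by
  have hfin : volume S ≠ ⊤ := hSb.measure_lt_top.ne
  have i1 := integrableOn_vertKer hfin c' t
  have i2 := integrableOn_vertKer hfin c t
  have e1 : ∀ u : ℝ, (c + c') / 2 - u + (c' - c) / 2 = c' - u := fun u => by ring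
  have e2 : ∀ u : ℝ, (c + c') / 2 - u - (c' - c) / 2 = c - u := fun u => by ring
  have key := hst.integral_neg_of_odd hSm hSb hSH hS0
    (f := fun d s => (s + t) / ((d + (c' - c) / 2) ^ 2 + (s + t) ^ 2) -
      (s + t) / ((d - (c' - c) / 2) ^ 2 + (s + t) ^ 2)) (c := (c + c') / 2)
    (fun d s => by
      rw [neg_sub, show (-d + (c' - c) / 2) ^ 2 = (d - (c' - c) / 2) ^ 2 by ring,
        show (-d - (c' - c) / 2) ^ 2 = (d + (c' - c) / 2) ^ 2 by ring]) ?_ (by linarith)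
    (by simp only [e1, e2]; exact i1.sub i2)
  · simp only [e1, e2] at key
    rw [integral_sub i1 i2] at key
    exact sub_neg.1 key
  · intro d s hd hs
    rw [sub_neg]
    apply div_lt_div_of_pos_left (by positivity) (by positivity)
    nlinarith [mul_pos hd (sub_pos.2 hcc')]

lemma vertKer_neg {S : Set (ℝ × ℝ)} (hst : SteinerSet S) (hSm : MeasurableSet S) (hSH : S ⊆ H)
    (c t : ℝ) : vertKer S (-c) t = vertKer S c t := by
  rw [vertKer, vertKer, ← integral_indicator hSm, ← integral_indicator hSm, ← integral_reflect 0]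
  congr 1 with y
  have hiff : reflect 0 y ∈ S ↔ y ∈ S := hst.reflect_zero_mem_iff hSH y
  by_cases hy : y ∈ S
  · rw [indicator_of_mem hy, indicator_of_mem (hiff.2 hy), reflect_apply]
    ring_nf
  · rw [indicator_of_notMem hy, indicator_of_notMem (fun h => hy (hiff.1 h))]

lemma vertKer_le_axis {S : Set (ℝ × ℝ)} (hst : SteinerSet S)
    (hSm : MeasurableSet S) (hSb : Bornology.IsBounded S) (hSH : S ⊆ H) (hS0 : 0 < volume.real S)
    (c : ℝ) {t : ℝ} (ht : 0 ≤ t) : vertKer S c t ≤ vertKer S 0 t := by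
  rcases lt_trichotomy c 0 with h | h | h
  · rw [← vertKer_neg hst hSm hSH]
    exact (vertKer_lt hst hSm hSb hSH hS0 ht le_rfl (by linarith)).le
  · rw [h]
  · exact (vertKer_lt hst hSm hSb hSH hS0 ht le_rfl h).le

lemma vertKer_pos {S : Set (ℝ × ℝ)} (hSm : MeasurableSet S) (hSb : Bornology.IsBounded S)
    (hSH : S ⊆ H) (hS0 : 0 < volume.real S) : 0 < vertKer S 0 0 := by
  have hfin : volume S ≠ ⊤ := hSb.measure_lt_top.ne
  have hpos : ∀ y ∈ S, 0 < (y.2 + 0) / ((0 - y.1) ^ 2 + (y.2 + 0) ^ 2) := fun y hy => by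
    have : 0 < y.2 := hSH hy
    simp only [add_zero]
    positivity
  rw [vertKer, setIntegral_pos_iff_support_of_nonneg_ae
    ((ae_restrict_iff' hSm).2 (ae_of_all _ fun y hy => (hpos y hy).le)) (integrableOn_vertKer hfin 0 0)]
  rw [Set.inter_eq_right.2 (show S ⊆ Function.support _ from fun y hy => (hpos y hy).ne')]
  exact (ENNReal.toReal_pos_iff.1 hS0).1

/-- Raising the height of the pole decreases the integral over a symmetric interval. -/
lemma setIntegral_poisson_anti {l s t : ℝ} (hl : 0 ≤ l) (hs : 0 < s) (ht : 0 ≤ t) :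
    ∫ y in Ioo (-l) l, (s + t) / ((0 - y) ^ 2 + (s + t) ^ 2) ≤
      ∫ y in Ioo (-l) l, (s + 0) / ((0 - y) ^ 2 + (s + 0) ^ 2) := by
  have key : ∀ a : ℝ, 0 < a → ∫ y in Ioo (-l) l, a / ((0 - y) ^ 2 + a ^ 2) =
      2 * Real.arctan (l / a) := by
    intro a ha
    rw [← integral_Ioc_eq_integral_Ioo, ← intervalIntegral.integral_of_le (by linarith)]
    have hd : ∀ y ∈ uIcc (-l) l,
        HasDerivAt (fun y => Real.arctan (y / a)) (a / ((0 - y) ^ 2 + a ^ 2)) y := fun y _ => by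
      refine ((hasDerivAt_id y).div_const a).arctan.congr_deriv ?_
      simp only [id]
      field_simp
      ring
    rw [intervalIntegral.integral_eq_sub_of_hasDerivAt hd]
    · rw [neg_div, Real.arctan_neg]; ring
    · refine Continuous.intervalIntegrable ?_ _ _
      refine continuous_const.div (by fun_prop) fun y => ?_
      positivity
  rw [key _ (by linarith), key _ (by linarith)]
  gcongr

/-- The half-width of the horizontal slice of `S` at height `t`. -/
def halfWidth (S : Set (ℝ × ℝ)) (t : ℝ) : ℝ := sSup {s | ((s, t) : ℝ × ℝ) ∈ S}

lemma bddAbove_slice {S : Set (ℝ × ℝ)} (hSb : Bornology.IsBounded S) (t : ℝ) :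
    BddAbove {s | ((s, t) : ℝ × ℝ) ∈ S} := by
  obtain ⟨R, hR⟩ := hSb.exists_norm_le
  exact ⟨R, fun s hs => (le_abs_self s).trans ((norm_fst_le _).trans (hR _ hs))⟩

/-- The horizontal slices of a bounded open Steiner symmetric set are symmetric intervals. -/
lemma SteinerSet.slice_eq {S : Set (ℝ × ℝ)} (hst : SteinerSet S) (hSo : IsOpen S)
    (hSb : Bornology.IsBounded S) {t : ℝ} (ht : 0 < t) :
    {s | ((s, t) : ℝ × ℝ) ∈ S} = Ioo (-(halfWidth S t)) (halfWidth S t) := by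
  have hbdd := bddAbove_slice hSb t
  have hopen : IsOpen {s | ((s, t) : ℝ × ℝ) ∈ S} := hSo.preimage (by fun_prop)
  have hlt : ∀ s, ((s, t) : ℝ × ℝ) ∈ S → s < halfWidth S t := by
    intro s hs
    obtain ⟨s', hmem, hs'⟩ :=
      ((eventually_mem_nhdsWithin (a := s) (s := Ioi s)).and
        (nhdsWithin_le_nhds (hopen.mem_nhds hs))).exists
    exact lt_of_lt_of_le hmem (le_csSup hbdd hs')
  ext s
  constructor
  · intro hs
    have := hlt _ ((hst.1 s t ht).1 hs)
    exact ⟨by linarith, hlt s hs⟩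
  · rintro ⟨h1, h2⟩
    have habs : |s| < halfWidth S t := abs_lt.2 ⟨h1, h2⟩
    have hne : {s | ((s, t) : ℝ × ℝ) ∈ S}.Nonempty := by
      by_contra! h
      rw [halfWidth, h, Real.sSup_empty] at habs
      exact absurd habs (abs_nonneg s).not_gt
    obtain ⟨b, hb, hsb⟩ := exists_lt_of_lt_csSup hne habs
    have hm := hst.2 t ht |s| b (abs_nonneg s) hsb.le hb
    rcases abs_cases s with ⟨e, -⟩ | ⟨e, -⟩
    · rwa [e] at hm
    · rw [e] at hm
      exact (hst.1 s t ht).2 hm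

lemma SteinerSet.halfWidth_nonneg {S : Set (ℝ × ℝ)} (hst : SteinerSet S)
    (hSb : Bornology.IsBounded S) {t : ℝ} (ht : 0 < t) : 0 ≤ halfWidth S t := by
  rcases {s | ((s, t) : ℝ × ℝ) ∈ S}.eq_empty_or_nonempty with h | ⟨s, hs⟩
  · rw [halfWidth, h, Real.sSup_empty]
  · have h1 := le_csSup (bddAbove_slice hSb t) hs
    have h2 := le_csSup (bddAbove_slice hSb t) ((hst.1 s t ht).1 hs)
    change s ≤ halfWidth S t at h1
    change -s ≤ halfWidth S t at h2
    linarith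

lemma vertKer_axis_anti {S : Set (ℝ × ℝ)} (hst : SteinerSet S) (hSo : IsOpen S)
    (hSb : Bornology.IsBounded S) (hSH : S ⊆ H) {t : ℝ} (ht : 0 ≤ t) :
    vertKer S 0 t ≤ vertKer S 0 0 := by
  have hfin : volume S ≠ ⊤ := hSb.measure_lt_top.ne
  have hSm := hSo.measurableSet
  have e : ∀ t : ℝ, Integrable (S.indicator
      fun y => (y.2 + t) / ((0 - y.1) ^ 2 + (y.2 + t) ^ 2)) :=
    fun t => (integrable_indicator_iff hSm).2 (integrableOn_vertKer hfin 0 t)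
  have slice : ∀ t s : ℝ, 0 < s → (∫ u, S.indicator
      (fun y => (y.2 + t) / ((0 - y.1) ^ 2 + (y.2 + t) ^ 2)) (u, s)) =
      ∫ u in Ioo (-(halfWidth S s)) (halfWidth S s), (s + t) / ((0 - u) ^ 2 + (s + t) ^ 2) := by
    intro t s hs
    have hm : MeasurableSet {u | ((u, s) : ℝ × ℝ) ∈ S} := hSm.preimage (by fun_prop)
    rw [← hst.slice_eq hSo hSb hs, ← integral_indicator hm]
    rfl
  rw [vertKer, vertKer, ← integral_indicator hSm, ← integral_indicator hSm,
    Measure.volume_eq_prod, integral_prod_symm _ (e t), integral_prod_symm _ (e 0)]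
  refine integral_mono (e t).integral_prod_right (e 0).integral_prod_right fun s => ?_
  rcases le_or_gt s 0 with hs | hs
  · have : ∀ u, ((u, s) : ℝ × ℝ) ∉ S := fun u h => hs.not_gt (hSH h)
    simp [this]
  · simp only [slice _ _ hs]
    exact setIntegral_poisson_anti (hst.halfWidth_nonneg hSb hs) hs ht

/-- The derivative of a `C¹` function that is nonpositive at both ends of an interval has zero
integral over the set where the function is positive. -/
lemma integral_indicator_deriv_eq_zero {f f' : ℝ → ℝ} (hf : ∀ t, HasDerivAt f (f' t) t)
    (hc : Continuous f') {R : ℝ} (hR : 0 ≤ R) (h0 : f 0 ≤ 0) (h1 : f R ≤ 0) :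
    ∫ t in 0..R, {t | 0 < f t}.indicator f' t = 0 := by
  have hfc : Continuous f := continuous_iff_continuousAt.2 fun t => (hf t).continuousAt
  obtain ⟨C, hC⟩ := (isCompact_Icc (a := (0 : ℝ)) (b := R)).exists_bound_of_continuousOn
    hc.continuousOn
  have hlip : LipschitzOnWith C.toNNReal f (uIcc 0 R) := by
    rw [uIcc_of_le hR]
    refine (convex_Icc 0 R).lipschitzOnWith_of_nnnorm_hasDerivWithin_le
      (fun t _ => (hf t).hasDerivWithinAt) fun t ht => ?_
    rw [← NNReal.coe_le_coe, coe_nnnorm]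
    exact (hC t ht).trans (Real.le_coe_toNNReal C)
  have hlip2 : LipschitzOnWith C.toNNReal (fun t => max (f t) 0) (uIcc 0 R) := by
    have := (LipschitzWith.id (α := ℝ)).max_const 0
    simpa [Function.comp_def] using this.comp_lipschitzOnWith hlip
  have hac := hlip2.absolutelyContinuousOnInterval.integral_deriv_eq_sub
  rw [max_eq_right h0, max_eq_right h1, sub_zero] at hac
  refine Eq.trans ?_ hac
  congr 1 with t
  rcases lt_trichotomy (f t) 0 with h | h | h
  · rw [indicator_of_notMem (by simp [h.le])]
    have : (fun t => max (f t) 0) =ᶠ[𝓝 t] fun _ => 0 := by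
      filter_upwards [hfc.continuousAt.eventually_lt continuousAt_const h] with s hs
      exact max_eq_right hs.le
    rw [this.deriv_eq, deriv_const]
  · rw [indicator_of_notMem (by simp [h])]
    have : IsLocalMin (fun t => max (f t) 0) t :=
      Eventually.of_forall fun s => by simp [h]
    exact this.deriv_eq_zero.symm
  · rw [indicator_of_mem (show t ∈ {t | 0 < f t} from h)]
    have : (fun t => max (f t) 0) =ᶠ[𝓝 t] f := by
      filter_upwards [continuousAt_const.eventually_lt hfc.continuousAt h] with s hs
      exact max_eq_left hs.le
    rw [this.deriv_eq, (hf t).deriv]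

lemma integral_im_cauchyPot {S : Set (ℝ × ℝ)} (hS : volume S ≠ ⊤) :
    ∫ x in S, cauchyPot S (cx x) = 0 := by
  have : IsFiniteMeasure (volume.restrict S) := ⟨by simpa using hS.lt_top⟩
  obtain ⟨C, hC0, hC⟩ := exists_riesz_bound hS (p := 1) zero_le_one one_lt_two
  have hmeas : AEStronglyMeasurable (Function.uncurry fun x y : ℝ × ℝ => (cx x - cx y)⁻¹)
      ((volume.restrict S).prod (volume.restrict S)) := by
    have h := cx.continuous.measurable
    exact Measurable.aestronglyMeasurable (by unfold Function.uncurry; fun_prop)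
  have hint : Integrable (Function.uncurry fun x y : ℝ × ℝ => (cx x - cx y)⁻¹)
      ((volume.restrict S).prod (volume.restrict S)) := by
    rw [integrable_prod_iff hmeas]
    refine ⟨ae_of_all _ fun x => integrableOn_cauchy hS (cx x), ?_⟩
    refine Integrable.of_bound hmeas.norm.integral_prod_right' C (ae_of_all _ fun x => ?_)
    rw [Real.norm_of_nonneg (integral_nonneg fun y => norm_nonneg _)]
    refine le_of_eq_of_le ?_ (hC (cx x)).2
    congr 1 with y
    simp [Real.rpow_neg_one]
  have hswap := integral_integral_swap hint
  have hneg : ∫ y in S, ∫ x in S, (cx x - cx y)⁻¹ = -∫ x in S, ∫ y in S, (cx x - cx y)⁻¹ := by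
    rw [← integral_neg]
    congr 1 with x
    rw [← integral_neg]
    congr 1 with y
    rw [← neg_sub, inv_neg]
  rw [hneg] at hswap
  exact self_eq_neg.1 hswap

lemma integrableOn_of_continuous {S : Set (ℝ × ℝ)} (hSb : Bornology.IsBounded S)
    {f : ℝ × ℝ → ℝ} (hf : Continuous f) : IntegrableOn f S :=
  (hf.continuousOn.integrableOn_compact (μ := volume) hSb.isCompact_closure).mono_set
    subset_closure

lemma hasDerivAt_stream_snd {S : Set (ℝ × ℝ)} (hSm : MeasurableSet S)
    (hS : Bornology.IsBounded S) (c t : ℝ) :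
    HasDerivAt (fun t => stream S (c, t)) (stream₂ S (c, t)) t := by
  have h := (hasFDerivAt_stream hSm hS (c, t)).comp_hasDerivAt t
    ((hasDerivAt_const t c).prodMk (hasDerivAt_id t))
  exact h.congr_deriv (by simp)

lemma hasDerivAt_stream_fst {S : Set (ℝ × ℝ)} (hSm : MeasurableSet S)
    (hS : Bornology.IsBounded S) (c t : ℝ) :
    HasDerivAt (fun c => stream S (c, t)) (stream₁ S (c, t)) c := by
  have h := (hasFDerivAt_stream hSm hS (c, t)).comp_hasDerivAt c
    ((hasDerivAt_id c).prodMk (hasDerivAt_const c t))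
  exact h.congr_deriv (by simp)

/-- Vertical force balance for a patch bounded by a streamline. -/
lemma integral_stream₂_sub {S : Set (ℝ × ℝ)} (hSo : IsOpen S) (hSb : Bornology.IsBounded S) {W : ℝ}
    (hS : ∀ x, x ∈ S ↔ 0 < x.2 ∧ 0 < stream S x - W * x.2) :
    ∫ x in S, (stream₂ S x - W) = 0 := by
  have hfin : volume S ≠ ⊤ := hSb.measure_lt_top.ne
  have hSm := hSo.measurableSet
  have hc := continuous_stream₂ hfin
  have hi : Integrable (S.indicator fun x => stream₂ S x - W) :=
    (integrable_indicator_iff hSm).2 (integrableOn_of_continuous hSb (by fun_prop))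
  obtain ⟨R, hR0, hR⟩ := hSb.exists_pos_norm_le
  rw [← integral_indicator hSm, Measure.volume_eq_prod, integral_prod _ hi]
  refine integral_eq_zero_of_ae (ae_of_all _ fun c => ?_)
  have hmem : ∀ t, 0 < t → (((c, t) : ℝ × ℝ) ∈ S ↔ 0 < stream S (c, t) - W * t) :=
    fun t ht => by simp [hS, ht]
  have hRt : ∀ t, ((c, t) : ℝ × ℝ) ∈ S → t ≤ R :=
    fun t ht => (le_abs_self t).trans ((norm_snd_le _).trans (hR _ ht))
  have key := integral_indicator_deriv_eq_zero (f := fun t => stream S (c, t) - W * t)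
    (f' := fun t => stream₂ S (c, t) - W) (R := R + 1)
    (fun t => ((hasDerivAt_stream_snd hSm hSb c t).sub
      ((hasDerivAt_id t).const_mul W)).congr_deriv (by simp))
    (by fun_prop) (by linarith) (by simp [stream_of_snd_eq_zero]) (by
      by_contra! h
      have := hRt _ ((hmem (R + 1) (by linarith)).2 h)
      linarith)
  rw [intervalIntegral.integral_of_le (by linarith)] at key
  simp only [Pi.zero_apply]
  rw [← key, ← integral_indicator measurableSet_Ioc]
  congr 1 with t
  by_cases ht : ((c, t) : ℝ × ℝ) ∈ S
  · have ht0 : 0 < t := ((hS _).1 ht).1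
    have hpos := (hmem t ht0).1 ht
    rw [indicator_of_mem ht, indicator_of_mem (show t ∈ Ioc 0 (R + 1) from ⟨ht0, (hRt t ht).trans (by linarith)⟩),
      indicator_of_mem (show t ∈ {t | 0 < stream S (c, t) - W * t} from hpos)]
  · rw [indicator_of_notMem ht]
    by_cases ht' : t ∈ Ioc 0 (R + 1)
    · rw [indicator_of_mem ht', indicator_of_notMem]
      exact fun h => ht ((hmem t ht'.1).2 h)
    · rw [indicator_of_notMem ht']

/-- The velocity at the centre of the axis exceeds the travelling speed. -/
lemma lt_stream₂_zero {S : Set (ℝ × ℝ)} (hst : SteinerSet S) (hSo : IsOpen S)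
    (hSb : Bornology.IsBounded S) (hSH : S ⊆ H) (hS0 : 0 < volume.real S) {W : ℝ}
    (hS : ∀ x, x ∈ S ↔ 0 < x.2 ∧ 0 < stream S x - W * x.2) :
    W < stream₂ S (0, 0) := by
  have hfin : volume S ≠ ⊤ := hSb.measure_lt_top.ne
  have hSm := hSo.measurableSet
  have h0 := integral_stream₂_sub hSo hSb hS
  have hc := continuous_stream₂ hfin
  have hcp := continuous_cauchyPot hfin
  have hcx := cx.continuous
  have i1 : IntegrableOn (fun x => stream₂ S x) S := integrableOn_of_continuous hSb hc
  have i2 : IntegrableOn (fun x => cauchyPot S (cx x)) S :=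
    ((hcp.comp hcx).continuousOn.integrableOn_compact (μ := volume) hSb.isCompact_closure).mono_set
      subset_closure
  have hz : ∫ x in S, (cauchyPot S (cx x)).im = 0 := by
    refine (integral_im i2).trans ?_
    rw [integral_im_cauchyPot hfin]
    simp
  have i3 : IntegrableOn (fun x => (cauchyPot S (cx x)).im) S := i2.im
  have hle : ∀ x ∈ S, stream₂ S x - W ≤
      ((1 / (2 * π)) * vertKer S 0 0 - W) + (1 / (2 * π)) * (cauchyPot S (cx x)).im := by
    intro x hx
    have hx2 : 0 < x.2 := hSH hx
    have h1 := (vertKer_le_axis hst hSm hSb hSH hS0 x.1 hx2.le).trans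
      (vertKer_axis_anti hst hSo hSb hSH hx2.le)
    have hp : 0 < 1 / (2 * π) := by positivity
    have h2 := mul_le_mul_of_nonneg_left h1 hp.le
    rw [stream₂, cauchyPot_conj_im hfin, mul_add]
    linarith
  have ic : IntegrableOn (fun _ => (1 / (2 * π)) * vertKer S 0 0 - W) S :=
    integrableOn_const hfin
  have hmono := setIntegral_mono_on (i1.sub (integrableOn_const hfin))
    (ic.add (i3.const_mul (1 / (2 * π)))) hSm hle
  simp only [Pi.sub_apply, Pi.add_apply] at hmono
  rw [h0, integral_add ic (i3.const_mul _), integral_const_mul, hz,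
    setIntegral_const, smul_eq_mul, mul_zero, add_zero] at hmono
  have h3 : 0 ≤ (1 / (2 * π)) * vertKer S 0 0 - W := nonneg_of_mul_nonneg_right hmono hS0
  have hpos := vertKer_pos hSm hSb hSH hS0
  rw [stream₂_axis hfin]
  have : 1 / π * vertKer S 0 0 = 2 * (1 / (2 * π) * vertKer S 0 0) := by field_simp
  have : 0 < 1 / (2 * π) * vertKer S 0 0 := by positivity
  linarith

lemma SteinerSet.mem_iff_abs_lt {S : Set (ℝ × ℝ)} (hst : SteinerSet S) (hSo : IsOpen S)
    (hSb : Bornology.IsBounded S) {c t : ℝ} (ht : 0 < t) :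
    ((c, t) : ℝ × ℝ) ∈ S ↔ |c| < halfWidth S t := by
  rw [abs_lt, ← mem_Ioo, ← hst.slice_eq hSo hSb ht]
  rfl

lemma continuous_stream {S : Set (ℝ × ℝ)} (hSm : MeasurableSet S) (hSb : Bornology.IsBounded S) :
    Continuous (stream S) :=
  continuous_iff_continuousAt.2 fun x => (hasFDerivAt_stream hSm hSb x).continuousAt

lemma stream_strictAntiOn {S : Set (ℝ × ℝ)} (hst : SteinerSet S)
    (hSm : MeasurableSet S) (hSb : Bornology.IsBounded S) (hSH : S ⊆ H) (hS0 : 0 < volume.real S)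
    {t : ℝ} (ht : 0 < t) : StrictAntiOn (fun c => stream S (c, t)) (Ici 0) := by
  have hc := continuous_stream hSm hSb
  refine strictAntiOn_of_deriv_neg (convex_Ici 0) (by fun_prop) fun c hc => ?_
  rw [interior_Ici] at hc
  rw [(hasDerivAt_stream_fst hSm hSb c t).deriv]
  exact stream₁_neg hst hSm hSb hSH hS0 hc ht

/-- The slope of the boundary streamline at a boundary point of a patch travelling at speed `W`. -/
def boundarySlope (S : Set (ℝ × ℝ)) (W : ℝ) (p : ℝ × ℝ) : ℝ :=
  -(stream₂ S p - W) / stream₁ S p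

lemma continuousAt_boundarySlope {S : Set (ℝ × ℝ)} (hS : volume S ≠ ⊤) (W : ℝ) {p : ℝ × ℝ}
    (hp : stream₁ S p ≠ 0) : ContinuousAt (boundarySlope S W) p :=
  ContinuousAt.div ((continuous_stream₂ hS).sub continuous_const).neg.continuousAt
    (continuous_stream₁ hS).continuousAt hp

section Boundary

variable {S : Set (ℝ × ℝ)} {W : ℝ}

lemma stream_halfWidth (hst : SteinerSet S) (hSo : IsOpen S) (hSb : Bornology.IsBounded S)
    (hS : ∀ x, x ∈ S ↔ 0 < x.2 ∧ 0 < stream S x - W * x.2) {t : ℝ} (ht : 0 < t)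
    (hl : 0 < halfWidth S t) : stream S (halfWidth S t, t) = W * t := by
  have hc := continuous_stream hSo.measurableSet hSb
  apply le_antisymm
  · by_contra! h
    have hm : ((halfWidth S t, t) : ℝ × ℝ) ∈ S := (hS _).2 ⟨ht, by simpa using h⟩
    rw [hst.mem_iff_abs_lt hSo hSb ht, abs_of_pos hl] at hm
    exact lt_irrefl _ hm
  · have h1 : Tendsto (fun c => stream S (c, t)) (𝓝[<] (halfWidth S t))
        (𝓝 (stream S (halfWidth S t, t))) :=
      ((show Continuous fun c => stream S (c, t) by fun_prop).tendsto _).mono_left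
        nhdsWithin_le_nhds
    refine ge_of_tendsto h1 ?_
    filter_upwards [Ioo_mem_nhdsLT hl] with c hc
    have hm : ((c, t) : ℝ × ℝ) ∈ S := by
      rw [hst.mem_iff_abs_lt hSo hSb ht, abs_of_pos hc.1]
      exact hc.2
    have := ((hS _).1 hm).2
    simp only at this
    linarith

lemma continuousOn_halfWidth (hst : SteinerSet S) (hSo : IsOpen S) (hSb : Bornology.IsBounded S)
    (hSH : S ⊆ H) (hS0 : 0 < volume.real S)
    (hS : ∀ x, x ∈ S ↔ 0 < x.2 ∧ 0 < stream S x - W * x.2) :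
    ContinuousOn (halfWidth S) (Ioi 0) := by
  have hc := continuous_stream hSo.measurableSet hSb
  intro t₀ ht₀
  refine ContinuousAt.continuousWithinAt (tendsto_order.2 ⟨fun a ha => ?_, fun b hb => ?_⟩)
  · rcases lt_or_ge a 0 with ha0 | ha0
    · filter_upwards [Ioi_mem_nhds ht₀] with t ht
      exact ha0.trans_le (hst.halfWidth_nonneg hSb ht)
    · have hm : ((a, t₀) : ℝ × ℝ) ∈ S := by
        rwa [hst.mem_iff_abs_lt hSo hSb ht₀, abs_of_nonneg ha0]
      have ho : IsOpen {t | ((a, t) : ℝ × ℝ) ∈ S} := hSo.preimage (by fun_prop)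
      filter_upwards [Ioi_mem_nhds ht₀, ho.mem_nhds hm] with t ht hat
      have hat : ((a, t) : ℝ × ℝ) ∈ S := hat
      rwa [hst.mem_iff_abs_lt hSo hSb ht, abs_of_nonneg ha0] at hat
  · obtain ⟨d, hd1, hd2⟩ := exists_between hb
    have h0 := hst.halfWidth_nonneg hSb ht₀
    have hd0 : 0 ≤ d := h0.trans hd1.le
    have h1 : stream S (halfWidth S t₀, t₀) ≤ W * t₀ := by
      by_contra! h
      have hm : ((halfWidth S t₀, t₀) : ℝ × ℝ) ∈ S := (hS _).2 ⟨ht₀, by simpa using h⟩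
      rw [hst.mem_iff_abs_lt hSo hSb ht₀, abs_of_nonneg h0] at hm
      exact lt_irrefl _ hm
    have h2 : stream S (d, t₀) < W * t₀ :=
      (stream_strictAntiOn hst hSo.measurableSet hSb hSH hS0 ht₀ h0 hd0 hd1).trans_le h1
    have h3 : ∀ᶠ t in 𝓝 t₀, stream S (d, t) < W * t :=
      ContinuousAt.eventually_lt (by fun_prop) (by fun_prop) h2
    filter_upwards [Ioi_mem_nhds ht₀, h3] with t ht hdt
    refine lt_of_not_ge fun hbt => ?_
    have hm : ((d, t) : ℝ × ℝ) ∈ S := by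
      rw [hst.mem_iff_abs_lt hSo hSb ht, abs_of_nonneg hd0]
      linarith
    have := ((hS _).1 hm).2
    simp only at this
    linarith

lemma isOpen_setOf_halfWidth_pos (hst : SteinerSet S) (hSo : IsOpen S)
    (hSb : Bornology.IsBounded S) : IsOpen {t | 0 < t ∧ 0 < halfWidth S t} := by
  have ho : IsOpen {t | ((0, t) : ℝ × ℝ) ∈ S} := hSo.preimage (by fun_prop)
  convert (isOpen_Ioi (a := (0 : ℝ))).inter ho using 1
  ext t
  simp only [mem_ofPred_eq, mem_inter_iff, mem_Ioi]
  refine and_congr_right fun ht => ?_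
  rw [hst.mem_iff_abs_lt hSo hSb ht, abs_zero]

lemma hasDerivAt_halfWidth (hst : SteinerSet S) (hSo : IsOpen S) (hSb : Bornology.IsBounded S)
    (hSH : S ⊆ H) (hS0 : 0 < volume.real S)
    (hS : ∀ x, x ∈ S ↔ 0 < x.2 ∧ 0 < stream S x - W * x.2) {t₀ : ℝ} (ht₀ : 0 < t₀)
    (hl₀ : 0 < halfWidth S t₀) :
    HasDerivAt (halfWidth S) (boundarySlope S W (halfWidth S t₀, t₀)) t₀ := by
  have hfin : volume S ≠ ⊤ := hSb.measure_lt_top.ne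
  have hSm := hSo.measurableSet
  have hlc : ContinuousAt (halfWidth S) t₀ :=
    (continuousOn_halfWidth hst hSo hSb hSH hS0 hS).continuousAt (Ioi_mem_nhds ht₀)
  have hmvt : ∀ t, ∃ z ∈ segment ℝ ((halfWidth S t₀, t₀) : ℝ × ℝ) (halfWidth S t, t),
      stream S (halfWidth S t, t) - stream S (halfWidth S t₀, t₀) =
        stream₁ S z * (halfWidth S t - halfWidth S t₀) + stream₂ S z * (t - t₀) := by
    intro t
    obtain ⟨z, hz, he⟩ := domain_mvt (f := stream S) (s := univ)
      (fun x _ => (hasFDerivAt_stream hSm hSb x).hasFDerivWithinAt) convex_univ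
      (mem_univ ((halfWidth S t₀, t₀) : ℝ × ℝ)) (mem_univ (halfWidth S t, t))
    exact ⟨z, hz, by rw [he]; simp⟩
  choose z hz hzeq using hmvt
  have hzt : Tendsto z (𝓝 t₀) (𝓝 (halfWidth S t₀, t₀)) := by
    rw [tendsto_iff_norm_sub_tendsto_zero]
    have h1 : Tendsto (fun t => ‖((halfWidth S t, t) : ℝ × ℝ) - (halfWidth S t₀, t₀)‖) (𝓝 t₀)
        (𝓝 0) :=
      tendsto_iff_norm_sub_tendsto_zero.1 (hlc.prodMk_nhds tendsto_id)
    exact squeeze_zero (fun _ => norm_nonneg _) (fun t => norm_sub_le_of_mem_segment (hz t)) h1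
  have hs₁ := stream₁_neg hst hSm hSb hSH hS0 (x := (halfWidth S t₀, t₀)) hl₀ ht₀
  have hD := (continuousAt_boundarySlope hfin W hs₁.ne).tendsto.comp hzt
  rw [hasDerivAt_iff_tendsto_slope]
  refine (hD.mono_left nhdsWithin_le_nhds).congr' ?_
  have hev : ∀ᶠ t in 𝓝 t₀, 0 < t ∧ 0 < halfWidth S t ∧ stream₁ S (z t) < 0 :=
    (eventually_gt_nhds ht₀).and ((hlc.eventually (eventually_gt_nhds hl₀)).and
      ((((continuous_stream₁ hfin).continuousAt.tendsto.comp hzt).eventually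
        (eventually_lt_nhds hs₁))))
  filter_upwards [nhdsWithin_le_nhds hev, self_mem_nhdsWithin] with t ⟨ht, hl, hz1⟩ hne
  have he := hzeq t
  rw [stream_halfWidth hst hSo hSb hS ht hl, stream_halfWidth hst hSo hSb hS ht₀ hl₀] at he
  have hne' : t - t₀ ≠ 0 := sub_ne_zero.2 hne
  simp only [Function.comp_apply]
  rw [slope_def_field, boundarySlope, div_eq_div_iff hz1.ne hne']
  linarith

lemma exists_holderOnWith_boundarySlope (hst : SteinerSet S) (hSo : IsOpen S)
    (hSb : Bornology.IsBounded S) (hSH : S ⊆ H) (hS0 : 0 < volume.real S)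
    (hS : ∀ x, x ∈ S ↔ 0 < x.2 ∧ 0 < stream S x - W * x.2) {r : ℝ≥0} (hr : (r : ℝ) < 1)
    {t₀ : ℝ} (ht₀ : 0 < t₀) (hl₀ : 0 < halfWidth S t₀) :
    ∃ s : Set ℝ, IsOpen s ∧ t₀ ∈ s ∧ s ⊆ {t | 0 < t ∧ 0 < halfWidth S t} ∧
      ∃ C : ℝ≥0, HolderOnWith C r (fun t => boundarySlope S W (halfWidth S t, t)) s := by
  have hfin : volume S ≠ ⊤ := hSb.measure_lt_top.ne
  have hSm := hSo.measurableSet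
  have hlc : ContinuousAt (halfWidth S) t₀ :=
    (continuousOn_halfWidth hst hSo hSb hSH hS0 hS).continuousAt (Ioi_mem_nhds ht₀)
  have hpc : ContinuousAt (fun t => ((halfWidth S t, t) : ℝ × ℝ)) t₀ := hlc.prodMk continuousAt_id
  have hs₁ := stream₁_neg hst hSm hSb hSH hS0 (x := (halfWidth S t₀, t₀)) hl₀ ht₀
  set D : ℝ → ℝ := fun t => boundarySlope S W (halfWidth S t, t) with hDdef
  have hDc : ContinuousAt D t₀ :=
    ContinuousAt.comp (f := fun t => ((halfWidth S t, t) : ℝ × ℝ))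
      (continuousAt_boundarySlope hfin W hs₁.ne) hpc
  set m := -stream₁ S (halfWidth S t₀, t₀) / 2 with hm
  have hm0 : 0 < m := by rw [hm]; linarith
  set K : ℝ := |D t₀| + 1 with hK
  have hK0 : 0 ≤ K := by positivity
  have hev : ∀ᶠ t in 𝓝 t₀, (t ∈ {t | 0 < t ∧ 0 < halfWidth S t}) ∧
      stream₁ S (halfWidth S t, t) < -m ∧ |D t| < K := by
    refine ((isOpen_setOf_halfWidth_pos hst hSo hSb).eventually_mem ⟨ht₀, hl₀⟩).and (.and ?_ ?_)
    · refine ((continuous_stream₁ hfin).continuousAt.comp hpc).eventually_lt_const ?_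
      simp only [Function.comp_apply, hm]
      linarith
    · exact hDc.abs.eventually_lt_const (lt_add_one _)
  obtain ⟨δ, hδ, hball⟩ := Metric.eventually_nhds_iff_ball.1 hev
  refine ⟨Metric.ball t₀ δ, Metric.isOpen_ball, Metric.mem_ball_self hδ,
    fun t ht => (hball t ht).1, ?_⟩
  obtain ⟨C, hC0, hC⟩ := stream_holder hfin r.2 hr
  have hlip : ∀ t ∈ Metric.ball t₀ δ, ∀ t' ∈ Metric.ball t₀ δ,
      |halfWidth S t - halfWidth S t'| ≤ K * |t - t'| := by
    intro t ht t' ht'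
    exact (convex_ball t₀ δ).norm_image_sub_le_of_norm_hasDerivWithin_le (f' := D)
      (fun x hx => (hasDerivAt_halfWidth hst hSo hSb hSH hS0 hS (hball x hx).1.1
        (hball x hx).1.2).hasDerivWithinAt) (fun x hx => (hball x hx).2.2.le) ht' ht
  have hbound : ∀ t ∈ Metric.ball t₀ δ, ∀ t' ∈ Metric.ball t₀ δ,
      |D t - D t'| ≤ ((1 + K) * C * (K + 1) ^ (r : ℝ) / m) * |t - t'| ^ (r : ℝ) := by
    intro t ht t' ht'
    obtain ⟨-, h1, -⟩ := hball t ht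
    obtain ⟨-, h1', hK'⟩ := hball t' ht'
    obtain ⟨e1, e2⟩ := hC (halfWidth S t, t) (halfWidth S t', t')
    have hn : ‖((halfWidth S t, t) : ℝ × ℝ) - (halfWidth S t', t')‖ ≤ (K + 1) * |t - t'| := by
      rw [Prod.mk_sub_mk, Prod.norm_mk, max_le_iff]
      have := hlip t ht t' ht'
      have h0 := abs_nonneg (t - t')
      refine ⟨this.trans (by nlinarith), ?_⟩
      rw [Real.norm_eq_abs]
      nlinarith
    set p := ((halfWidth S t, t) : ℝ × ℝ) with hp
    set p' := ((halfWidth S t', t') : ℝ × ℝ) with hp'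
    have hpow : ‖p - p'‖ ^ (r : ℝ) ≤ (K + 1) ^ (r : ℝ) * |t - t'| ^ (r : ℝ) := by
      rw [← Real.mul_rpow (by positivity) (abs_nonneg _)]
      exact Real.rpow_le_rpow (norm_nonneg _) hn r.2
    have hd : stream₁ S p ≠ 0 := by linarith
    have hd' : stream₁ S p' ≠ 0 := by linarith
    have hid : D t - D t' = (-(stream₂ S p - stream₂ S p') -
        D t' * (stream₁ S p - stream₁ S p')) / stream₁ S p := by
      simp only [hDdef, boundarySlope, ← hp, ← hp']
      field_simp
      ring
    rw [hid, abs_div, abs_of_neg (show stream₁ S p < 0 by linarith)]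
    have hnum : |-(stream₂ S p - stream₂ S p') - D t' * (stream₁ S p - stream₁ S p')| ≤
        (1 + K) * (C * ((K + 1) ^ (r : ℝ) * |t - t'| ^ (r : ℝ))) := by
      have f2 := e2.trans (mul_le_mul_of_nonneg_left hpow hC0)
      have f1 := e1.trans (mul_le_mul_of_nonneg_left hpow hC0)
      refine (abs_sub _ _).trans ?_
      rw [abs_neg, abs_mul, add_mul, one_mul]
      gcongr
    calc _ ≤ (1 + K) * (C * ((K + 1) ^ (r : ℝ) * |t - t'| ^ (r : ℝ))) / m := by
          gcongr
          linarith
      _ = _ := by ring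
  refine ⟨((1 + K) * C * (K + 1) ^ (r : ℝ) / m).toNNReal, fun t ht t' ht' => ?_⟩
  rw [edist_dist, edist_dist, ENNReal.ofReal_rpow_of_nonneg dist_nonneg r.coe_nonneg]
  change _ ≤ ENNReal.ofReal _ * _
  rw [← ENNReal.ofReal_mul (by positivity)]
  exact ENNReal.ofReal_le_ofReal (hbound t ht t' ht')

lemma tendsto_stream_div_snd (hSm : MeasurableSet S) (hSb : Bornology.IsBounded S) (c : ℝ) :
    Tendsto (fun t => stream S (c, t) / t) (𝓝[>] 0) (𝓝 (stream₂ S (c, 0))) := by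
  have h := (hasDerivAt_iff_tendsto_slope.1 (hasDerivAt_stream_snd hSm hSb c 0)).mono_left
    (nhdsWithin_mono 0 fun t (ht : 0 < t) => ht.ne')
  refine h.congr fun t => ?_
  rw [slope_def_field, stream_of_snd_eq_zero, sub_zero, sub_zero]

lemma eventually_lt_halfWidth (hst : SteinerSet S) (hSo : IsOpen S) (hSb : Bornology.IsBounded S)
    (hS : ∀ x, x ∈ S ↔ 0 < x.2 ∧ 0 < stream S x - W * x.2) {c : ℝ}
    (h : W < stream₂ S (c, 0)) : ∀ᶠ t in 𝓝[>] 0, c < halfWidth S t := by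
  filter_upwards [(tendsto_stream_div_snd hSo.measurableSet hSb c).eventually_const_lt h,
    self_mem_nhdsWithin] with t h1 ht
  rw [lt_div_iff₀ ht] at h1
  have hm : ((c, t) : ℝ × ℝ) ∈ S := (hS _).2 ⟨ht, by simpa using h1⟩
  rw [hst.mem_iff_abs_lt hSo hSb ht] at hm
  exact (le_abs_self c).trans_lt hm

lemma eventually_halfWidth_le (hst : SteinerSet S) (hSo : IsOpen S) (hSb : Bornology.IsBounded S)
    (hS : ∀ x, x ∈ S ↔ 0 < x.2 ∧ 0 < stream S x - W * x.2) {c : ℝ} (hc : 0 ≤ c)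
    (h : stream₂ S (c, 0) < W) : ∀ᶠ t in 𝓝[>] 0, halfWidth S t ≤ c := by
  filter_upwards [(tendsto_stream_div_snd hSo.measurableSet hSb c).eventually_lt_const h,
    self_mem_nhdsWithin] with t h1 ht
  rw [div_lt_iff₀ ht] at h1
  refine le_of_not_gt fun hlt => ?_
  have hm : ((c, t) : ℝ × ℝ) ∈ S := by
    rwa [hst.mem_iff_abs_lt hSo hSb ht, abs_of_nonneg hc]
  have := ((hS _).1 hm).2
  simp only at this
  linarith

/-- The boundary streamline reaches the axis at a positive distance from the centre. -/
lemma exists_tendsto_halfWidth (hst : SteinerSet S) (hSo : IsOpen S)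
    (hSb : Bornology.IsBounded S) (hSH : S ⊆ H) (hS0 : 0 < volume.real S)
    (hS : ∀ x, x ∈ S ↔ 0 < x.2 ∧ 0 < stream S x - W * x.2) :
    ∃ a : ℝ, 0 < a ∧ Tendsto (halfWidth S) (𝓝[>] 0) (𝓝 a) := by
  have hfin : volume S ≠ ⊤ := hSb.measure_lt_top.ne
  have hSm := hSo.measurableSet
  have hu0 := lt_stream₂_zero hst hSo hSb hSH hS0 hS
  have hanti : StrictAntiOn (fun c => stream₂ S (c, 0)) (Ici 0) := by
    intro c hc c' _ hcc'
    simp only [stream₂_axis hfin]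
    gcongr
    exact vertKer_lt hst hSm hSb hSH hS0 le_rfl hc hcc'
  obtain ⟨R, hR0, hR⟩ := hSb.exists_pos_norm_le
  have huR : stream₂ S (R, 0) ≤ W := by
    by_contra! h
    obtain ⟨t, h1, ht⟩ :=
      ((eventually_lt_halfWidth hst hSo hSb hS h).and self_mem_nhdsWithin).exists
    refine h1.not_ge (Real.sSup_le (fun s hs => ?_) hR0.le)
    exact (le_abs_self s).trans ((norm_fst_le _).trans (hR _ hs))
  have hc := continuous_stream₂ hfin
  obtain ⟨a, ⟨ha0, -⟩, haW⟩ := intermediate_value_Icc' hR0.le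
    (f := fun c => stream₂ S (c, 0)) (by fun_prop) ⟨huR, hu0.le⟩
  simp only at haW
  have ha : 0 < a := by
    rcases ha0.eq_or_lt with h | h
    · rw [← h] at haW
      exact absurd haW hu0.ne'
    · exact h
  refine ⟨a, ha, tendsto_order.2 ⟨fun b hb => ?_, fun b hb => ?_⟩⟩
  · have h1 : W < stream₂ S (max b 0, 0) := by
      rw [← haW]
      exact hanti (le_max_right b 0) ha0 (max_lt hb ha)
    filter_upwards [eventually_lt_halfWidth hst hSo hSb hS h1] with t ht
    exact (le_max_left b 0).trans_lt ht
  · obtain ⟨d, hd1, hd2⟩ := exists_between hb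
    have h1 : stream₂ S (d, 0) < W := by
      rw [← haW]
      exact hanti ha0 (ha0.trans hd1.le) hd1
    filter_upwards [eventually_halfWidth_le hst hSo hSb hS (ha0.trans hd1.le) h1] with t ht
    exact ht.trans_lt hd2

end Boundary

/-- continuity of the boundary streamline of a small-impulse
Steiner-symmetric maximizing patch. -/
theorem boundary_streamline_continuity :
    ∃ M₁ : ℝ, 0 < M₁ ∧
    ∀ (M W : ℝ) (ω : ℝ × ℝ → ℝ) (Ω : Set (ℝ × ℝ)),
      0 < M → M < M₁ → 0 < W → memS M ω → SteinerFn ω →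
      Ω = {y ∈ H | 0 < Gpot ω y - W * y.2} →
      (∀ x ∈ H, ω x = Ω.indicator (fun _ => (1 : ℝ)) x) →
      IsOpen Ω → Bornology.IsBounded Ω →
      ∃ (A : Set ℝ) (l : ℝ → ℝ),
        A = {t : ℝ | 0 < t ∧ (((0 : ℝ), t) : ℝ × ℝ) ∈ Ω} ∧
        -- (i)
        A.Nonempty ∧ Bornology.IsBounded A ∧ IsOpen A ∧
        (∃ ε : ℝ, 0 < ε ∧ Set.Ioo (0 : ℝ) ε ⊆ A) ∧
        (∀ t : ℝ, 0 < t → 0 ≤ l t) ∧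
        (∀ t ∈ A, {s : ℝ | ((s, t) : ℝ × ℝ) ∈ Ω} = Set.Ioo (-(l t)) (l t)) ∧
        (∀ t : ℝ, 0 < t → t ∉ A → l t = 0) ∧
        -- (ii)
        ContinuousOn l (Set.Ioi (0 : ℝ)) ∧
        (∃ l' : ℝ → ℝ,
          (∀ t ∈ A, HasDerivAt l (l' t) t) ∧
          (∀ r : ℝ≥0, 0 < r → (r : ℝ) < 1 → ∀ t ∈ A,
            ∃ s : Set ℝ, IsOpen s ∧ t ∈ s ∧ s ⊆ A ∧
              ∃ Ch : ℝ≥0, HolderOnWith Ch r l' s)) ∧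
        (∀ t ∈ A, Gpot ω (l t, t) = W * t) ∧
        -- (iii)
        (∃ a : ℝ, 0 < a ∧ Filter.Tendsto l (nhdsWithin 0 (Set.Ioi 0)) (nhds a)) := by
  refine ⟨1, one_pos, fun M W ω Ω hM _ _ hωS hωst hΩ hω hSo hSb => ?_⟩
  have hSH : Ω ⊆ H := fun y hy => by
    rw [hΩ] at hy
    exact hy.1
  have hSm := hSo.measurableSet
  have hS : ∀ x, x ∈ Ω ↔ 0 < x.2 ∧ 0 < stream Ω x - W * x.2 := by
    intro x
    conv_lhs => rw [hΩ]
    refine and_congr_right fun hx => ?_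
    rw [Gpot_eq_stream hSm hSb hSH hω hx]
  have hst : SteinerSet Ω := by
    have hind : ∀ x ∈ H, x ∈ Ω ↔ 0 < ω x := fun x hx => by
      rw [hω x hx]
      by_cases h : x ∈ Ω <;> simp [h]
    refine ⟨fun x₁ x₂ h => ?_, fun x₂ h a b ha hab hb => ?_⟩
    · rw [hind _ h, hind _ h, hωst.1 x₁ x₂ h]
    · rw [hind _ h] at hb ⊢
      exact hb.trans_le (hωst.2 x₂ h a b ha hab)
  have hne : Ω.Nonempty := by
    by_contra! hemp
    obtain ⟨-, A, hAH, hAm, hAω, hAM, -⟩ := hωS.1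
    have hA0 : volume A = 0 := by
      rw [ae_restrict_iff' measurableSet_H] at hAω
      refine measure_mono_null (fun x hx => ?_) (ae_iff.1 hAω)
      simp [hAH hx, hω x (hAH hx), hx, hemp]
    rw [setIntegral_measure_zero _ hA0] at hAM
    exact hM.ne hAM
  have hS0 : 0 < volume.real Ω :=
    ENNReal.toReal_pos (hSo.measure_pos volume hne).ne' hSb.measure_lt_top.ne
  have hA : {t : ℝ | 0 < t ∧ (((0 : ℝ), t) : ℝ × ℝ) ∈ Ω} = {t | 0 < t ∧ 0 < halfWidth Ω t} := by
    ext t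
    refine and_congr_right fun ht => ?_
    rw [hst.mem_iff_abs_lt hSo hSb ht, abs_zero]
  obtain ⟨a, ha, hlim⟩ := exists_tendsto_halfWidth hst hSo hSb hSH hS0 hS
  obtain ⟨ε, hε, hεA⟩ : ∃ ε : ℝ, 0 < ε ∧ Ioo 0 ε ⊆ {t | 0 < t ∧ 0 < halfWidth Ω t} := by
    obtain ⟨ε, hε, hsub⟩ := mem_nhdsGT_iff_exists_Ioo_subset.1
      (hlim.eventually (eventually_gt_nhds ha))
    exact ⟨ε, hε, fun t ht => ⟨ht.1, hsub ht⟩⟩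
  refine ⟨_, halfWidth Ω, rfl, ?_⟩
  rw [hA]
  refine ⟨(nonempty_Ioo.2 hε).mono hεA, ?_, isOpen_setOf_halfWidth_pos hst hSo hSb, ⟨ε, hε, hεA⟩,
    fun t ht => hst.halfWidth_nonneg hSb ht, fun t ht => hst.slice_eq hSo hSb ht.1,
    fun t ht hlt => ?_, continuousOn_halfWidth hst hSo hSb hSH hS0 hS,
    ⟨_, fun t ht => hasDerivAt_halfWidth hst hSo hSb hSH hS0 hS ht.1 ht.2,
      fun r _ hr t ht => exists_holderOnWith_boundarySlope hst hSo hSb hSH hS0 hS hr ht.1 ht.2⟩,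
    fun t ht => ?_, a, ha, hlim⟩
  · rw [← hA]
    obtain ⟨R, hR⟩ := hSb.exists_norm_le
    exact (Metric.isBounded_closedBall (x := (0 : ℝ)) (r := R)).subset fun t ht =>
      mem_closedBall_zero_iff.2 ((norm_snd_le _).trans (hR _ ht.2))
  · exact le_antisymm (le_of_not_gt fun h => hlt ⟨ht, h⟩) (hst.halfWidth_nonneg hSb ht)
  · rw [Gpot_eq_stream hSm hSb hSH hω ht.1]
    exact stream_halfWidth hst hSo hSb hS ht.1 ht.2
end
end

section
/- (Small-impulse estimates.) There exist constants C ≥ 1 and M₁ > 0 such that for every M ∈ (0, M₁), every ω ∈ S_M, and every W > 0 with ω = 1_{{x ∈ ℝ²₊ : 𝒢[ω](x) − W·x₂ > 0}} a.e. in ℝ²₊, the following hold: (1/C)·M^{2/3} ≤ ‖ω‖₁ ≤ C·M^{2/3}; (1/C)·M^{4/3} ≤ E(ω) ≤ C·M^{4/3}; (1/C)·M^{1/3} ≤ W ≤ C·M^{1/3}; and |𝒢[ω](x)| ≤ C·M^{2/3} for every x ∈ ℝ²₊. -/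
open MeasureTheory Real Set NNReal Filter Topology

noncomputable section

/-- The one-dimensional kernel `|t|^{-1/2}` truncated to `|t| < s`. -/
def truncKernel (s t : ℝ) : ℝ := (Iio s).indicator (fun r => (√r)⁻¹) |t|

/-- A separable majorant of the truncated kernel `1 / |z|`. -/
def prodKernel (s : ℝ) (z : ℝ × ℝ) : ℝ := truncKernel s z.1 * truncKernel s z.2

lemma truncKernel_nonneg (s t : ℝ) : 0 ≤ truncKernel s t :=
  Set.indicator_nonneg (fun _ _ => by positivity) _

lemma prodKernel_nonneg (s : ℝ) (z : ℝ × ℝ) : 0 ≤ prodKernel s z :=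
  mul_nonneg (truncKernel_nonneg _ _) (truncKernel_nonneg _ _)

lemma integral_truncKernel {s : ℝ} (hs : 0 < s) : ∫ t, truncKernel s t = 4 * √s := by
  unfold truncKernel
  rw [integral_comp_abs (f := (Iio s).indicator (fun r => (√r)⁻¹)),
    setIntegral_indicator measurableSet_Iio, Ioi_inter_Iio, ← integral_Ioc_eq_integral_Ioo,
    ← intervalIntegral.integral_of_le hs.le]
  have h : ∫ r in (0 : ℝ)..s, (√r)⁻¹ = ∫ r in (0 : ℝ)..s, r ^ (-(1 / 2) : ℝ) := by
    refine intervalIntegral.integral_congr fun r hr => ?_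
    rw [uIcc_of_le hs.le] at hr
    simp only [Real.sqrt_eq_rpow, Real.rpow_neg hr.1]
  rw [h, integral_rpow (Or.inl (by norm_num)), Real.sqrt_eq_rpow]
  norm_num [Real.zero_rpow]
  ring

lemma integrable_truncKernel {s : ℝ} (hs : 0 < s) : Integrable (truncKernel s) := by
  by_contra h
  have h1 := integral_truncKernel hs
  rw [integral_undef h] at h1
  have := Real.sqrt_pos.2 hs
  linarith

lemma integrable_prodKernel {s : ℝ} (hs : 0 < s) (x : ℝ × ℝ) :
    Integrable fun y => prodKernel s (x - y) :=
  Integrable.comp_sub_left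
    (Integrable.mul_prod (integrable_truncKernel hs) (integrable_truncKernel hs)) x

lemma integral_prodKernel {s : ℝ} (hs : 0 < s) (x : ℝ × ℝ) :
    ∫ y, prodKernel s (x - y) = 16 * s := by
  rw [integral_sub_left_eq_self (prodKernel s) volume x]
  unfold prodKernel
  rw [Measure.volume_eq_prod, integral_prod_mul, integral_truncKernel hs]
  nlinarith [Real.mul_self_sqrt hs.le]

/-- Squared Euclidean distance. -/
def sqDist (x y : ℝ × ℝ) : ℝ := (x.1 - y.1) ^ 2 + (x.2 - y.2) ^ 2

lemma sqDist_comm (x y : ℝ × ℝ) : sqDist x y = sqDist y x := by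
  unfold sqDist; ring

lemma sqDist_nonneg (x y : ℝ × ℝ) : 0 ≤ sqDist x y := by
  unfold sqDist; positivity

lemma G_def (x y : ℝ × ℝ) :
    G x y = (1 / (4 * π)) * Real.log (1 + 4 * x.2 * y.2 / sqDist x y) := rfl

lemma G_comm (x y : ℝ × ℝ) : G x y = G y x := by
  rw [G_def, G_def, sqDist_comm x y]; ring_nf

lemma G_nonneg {x y : ℝ × ℝ} (hx : x ∈ H) (hy : y ∈ H) : 0 ≤ G x y := by
  have hx' : 0 < x.2 := hx
  have hy' : 0 < y.2 := hy
  have := sqDist_nonneg x y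
  rw [G_def]
  exact mul_nonneg (by positivity) (Real.log_nonneg (le_add_of_nonneg_right (by positivity)))

lemma measurable_G : Measurable (Function.uncurry G) := by
  unfold Function.uncurry G
  fun_prop

lemma log_one_add_le {t : ℝ} (ht : 0 ≤ t) : Real.log (1 + t) ≤ t := by
  have := Real.log_le_sub_one_of_pos (show 0 < 1 + t by linarith)
  linarith

lemma log_one_add_le_sqrt {t : ℝ} (ht : 0 ≤ t) : Real.log (1 + t) ≤ 2 * √t := by
  have h0 := Real.sqrt_nonneg t
  have h1 : Real.log (1 + t) ≤ Real.log ((1 + √t) ^ 2) := by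
    apply Real.log_le_log (by linarith)
    nlinarith [Real.sq_sqrt ht]
  rw [Real.log_pow] at h1
  have := log_one_add_le h0
  push_cast at h1
  linarith

lemma inv_four_pi_mul_le {a b : ℝ} (hb : 0 ≤ b) (h : a ≤ 12 * b) :
    (1 / (4 * π)) * a ≤ b := by
  have := Real.pi_gt_three
  rw [one_div, inv_mul_le_iff₀ (by positivity)]
  nlinarith

lemma G_le_div_sqDist {x y : ℝ × ℝ} (hx : x ∈ H) (hy : y ∈ H) :
    G x y ≤ x.2 * y.2 / sqDist x y := by
  have hx' : 0 < x.2 := hx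
  have hy' : 0 < y.2 := hy
  have := sqDist_nonneg x y
  rw [G_def]
  refine inv_four_pi_mul_le (by positivity) ((log_one_add_le (by positivity)).trans ?_)
  rw [mul_assoc, mul_div_assoc]
  gcongr
  norm_num

lemma G_le_div_sqrt {x y : ℝ × ℝ} (hx : x ∈ H) (hy : y ∈ H) (hxy : 0 < sqDist x y) :
    G x y ≤ x.2 / √(sqDist x y) := by
  have hx' : 0 < x.2 := hx
  have hy' : 0 < y.2 := hy
  have hq : 0 < √(sqDist x y) := Real.sqrt_pos.2 hxy
  by_cases h : y.2 ≤ 4 * x.2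
  · rw [G_def]
    refine inv_four_pi_mul_le (by positivity) ((log_one_add_le_sqrt (by positivity)).trans ?_)
    have h1 : √(4 * x.2 * y.2 / sqDist x y) ≤ 4 * x.2 / √(sqDist x y) := by
      rw [Real.sqrt_div (by positivity)]
      gcongr
      rw [Real.sqrt_le_left (by positivity)]
      nlinarith
    calc 2 * √(4 * x.2 * y.2 / sqDist x y) ≤ 2 * (4 * x.2 / √(sqDist x y)) := by gcongr
      _ = 8 * (x.2 / √(sqDist x y)) := by ring
      _ ≤ _ := by gcongr; norm_num
  · push Not at h
    rw [G_def]
    refine inv_four_pi_mul_le (by positivity) ((log_one_add_le (by positivity)).trans ?_)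
    have h1 : y.2 ≤ 2 * √(sqDist x y) := by
      have : y.2 / 2 ≤ √(sqDist x y) := by
        apply Real.le_sqrt_of_sq_le
        unfold sqDist
        nlinarith [sq_nonneg (x.1 - y.1)]
      linarith
    rw [div_le_iff₀ hxy, ← mul_div_assoc, div_mul_eq_mul_div, le_div_iff₀ hq]
    nth_rw 2 [← Real.mul_self_sqrt hxy.le]
    nlinarith [mul_pos hx' hq, mul_pos (mul_pos hx' hq) hq,
      mul_le_mul_of_nonneg_left h1 (mul_pos hx' hq).le]

lemma prodKernel_eq {s : ℝ} {x y : ℝ × ℝ} (h : dist y x < s) :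
    prodKernel s (x - y) = (√|x.1 - y.1|)⁻¹ * (√|x.2 - y.2|)⁻¹ := by
  rw [Prod.dist_eq, max_lt_iff, Real.dist_eq, Real.dist_eq, abs_sub_comm, abs_sub_comm y.2] at h
  simp [prodKernel, truncKernel, indicator, h.1, h.2]

lemma inv_sqrt_sqDist_le {s : ℝ} {x y : ℝ × ℝ} (h1 : x.1 ≠ y.1) (h2 : x.2 ≠ y.2)
    (h : dist y x < s) : (√(sqDist x y))⁻¹ ≤ prodKernel s (x - y) := by
  have h1' := abs_pos.2 (sub_ne_zero.2 h1)
  have h2' := abs_pos.2 (sub_ne_zero.2 h2)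
  rw [prodKernel_eq h, ← mul_inv, ← Real.sqrt_mul h1'.le]
  gcongr
  unfold sqDist
  nlinarith [sq_abs (x.1 - y.1), sq_abs (x.2 - y.2), sq_nonneg (|x.1 - y.1| - |x.2 - y.2|)]

lemma sq_le_sqDist {s : ℝ} (hs : 0 ≤ s) {x y : ℝ × ℝ} (h : s ≤ dist y x) :
    s ^ 2 ≤ sqDist x y := by
  rw [Prod.dist_eq, le_max_iff, Real.dist_eq, Real.dist_eq] at h
  unfold sqDist
  rcases h with h | h
  · nlinarith [sq_abs (y.1 - x.1), sq_nonneg (x.2 - y.2)]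
  · nlinarith [sq_abs (y.2 - x.2), sq_nonneg (x.1 - y.1)]

lemma sqDist_le_sq {s : ℝ} {x y : ℝ × ℝ} (h : dist y x < s) :
    sqDist x y ≤ 2 * s ^ 2 := by
  rw [Prod.dist_eq, max_lt_iff, Real.dist_eq, Real.dist_eq] at h
  unfold sqDist
  nlinarith [sq_abs (y.1 - x.1), sq_abs (y.2 - x.2), abs_nonneg (y.1 - x.1),
    abs_nonneg (y.2 - x.2)]

lemma sqDist_pos {x y : ℝ × ℝ} (h1 : x.1 ≠ y.1) : 0 < sqDist x y := by
  have := sq_pos_of_ne_zero (sub_ne_zero.2 h1)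
  unfold sqDist
  positivity

/-- Pointwise bound of the Green function, linear in the height of `x`. -/
lemma G_le_linear {s R : ℝ} (hs : 0 < s) (hR : 0 < R) {x y : ℝ × ℝ} (hx : x ∈ H) (hy : y ∈ H)
    (h1 : x.1 ≠ y.1) (h2 : x.2 ≠ y.2) :
    G x y ≤ x.2 / s ^ 2 * (Metric.ball x R).indicator (fun y => y.2) y
      + x.2 / R ^ 2 * y.2 + x.2 * prodKernel s (x - y) := by
  have hx' : 0 < x.2 := hx
  have hy' : 0 < y.2 := hy
  have hk := prodKernel_nonneg s (x - y)
  have hD := sqDist_pos h1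
  have hi : 0 ≤ (Metric.ball x R).indicator (fun y : ℝ × ℝ => y.2) y :=
    indicator_apply_nonneg fun _ => hy'.le
  have A1 : 0 ≤ x.2 / s ^ 2 * (Metric.ball x R).indicator (fun y => y.2) y := by positivity
  have A2 : 0 ≤ x.2 / R ^ 2 * y.2 := by positivity
  have A3 : 0 ≤ x.2 * prodKernel s (x - y) := by positivity
  by_cases hds : dist y x < s
  · have B := (G_le_div_sqrt hx hy hD).trans
      (mul_le_mul_of_nonneg_left (inv_sqrt_sqDist_le h1 h2 hds) hx'.le)
    linarith
  by_cases hdR : dist y x < R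
  · have B := (G_le_div_sqDist hx hy).trans (div_le_div_of_nonneg_left (by positivity)
      (by positivity) (sq_le_sqDist hs.le (not_lt.1 hds)))
    rw [indicator_of_mem (Metric.mem_ball.2 hdR)]
    rw [mul_div_right_comm] at B
    linarith
  · have B := (G_le_div_sqDist hx hy).trans (div_le_div_of_nonneg_left (by positivity)
      (by positivity) (sq_le_sqDist hR.le (not_lt.1 hdR)))
    rw [mul_div_right_comm] at B
    linarith

/-- Pointwise bound of the Green function, uniform in `x`. -/
lemma G_le_uniform {s : ℝ} (hs : 0 < s) {x y : ℝ × ℝ} (hx : x ∈ H) (hy : y ∈ H)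
    (h1 : x.1 ≠ y.1) (h2 : x.2 ≠ y.2) :
    G x y ≤ s⁻¹ * y.2 + s * prodKernel s (x - y) := by
  have hx' : 0 < x.2 := hx
  have hy' : 0 < y.2 := hy
  have hk := prodKernel_nonneg s (x - y)
  have hD := sqDist_pos h1
  have hq := Real.sqrt_pos.2 hD
  by_cases hds : dist y x < s
  · have hB := inv_sqrt_sqDist_le h1 h2 hds
    have hq2 : √(sqDist x y) ≤ 2 * s := by
      rw [Real.sqrt_le_left (by positivity)]
      nlinarith [sqDist_le_sq hds, sq_nonneg s]
    have hxy : x.2 ≤ y.2 + s := by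
      rw [Prod.dist_eq, max_lt_iff, Real.dist_eq, Real.dist_eq] at hds
      linarith [(abs_lt.1 hds.2).1]
    have hone : 1 ≤ 2 * (s * (√(sqDist x y))⁻¹) := by
      rw [← mul_assoc, ← div_eq_mul_inv, le_div_iff₀ hq]
      linarith
    have hlog : Real.log (1 + 4 * x.2 * y.2 / sqDist x y) ≤
        Real.log (1 + 4 * x.2 * y.2 / s ^ 2) + Real.log (1 + s ^ 2 / sqDist x y) := by
      rw [← Real.log_mul (by positivity) (by positivity)]
      apply Real.log_le_log (by positivity)
      have : 4 * x.2 * y.2 / s ^ 2 * (s ^ 2 / sqDist x y) = 4 * x.2 * y.2 / sqDist x y := by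
        field_simp
      have e1 : 0 ≤ 4 * x.2 * y.2 / s ^ 2 := by positivity
      have e2 : 0 ≤ s ^ 2 / sqDist x y := by positivity
      nlinarith
    have hl1 : Real.log (1 + 4 * x.2 * y.2 / s ^ 2) ≤ 4 * (s⁻¹ * y.2 + 1) := by
      refine (log_one_add_le_sqrt (by positivity)).trans ?_
      have : √(4 * x.2 * y.2 / s ^ 2) ≤ 2 * (s⁻¹ * y.2 + 1) := by
        rw [Real.sqrt_le_left (by positivity)]
        have : 2 * (s⁻¹ * y.2 + 1) = 2 * (y.2 + s) / s := by field_simp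
        rw [this, div_pow]
        gcongr
        nlinarith
      linarith
    have hl2 : Real.log (1 + s ^ 2 / sqDist x y) ≤ 2 * (s * (√(sqDist x y))⁻¹) := by
      refine (log_one_add_le_sqrt (by positivity)).trans ?_
      rw [Real.sqrt_div (by positivity), Real.sqrt_sq hs.le, div_eq_mul_inv]
    rw [G_def]
    refine (inv_four_pi_mul_le (b := s⁻¹ * y.2 + s * (√(sqDist x y))⁻¹) (by positivity) ?_).trans
      (by gcongr)
    have : 0 ≤ s⁻¹ * y.2 := by positivity
    linarith
  · have h3 : s ≤ √(sqDist x y) := Real.le_sqrt_of_sq_le (sq_le_sqDist hs.le (not_lt.1 hds))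
    have B := G_le_div_sqrt hy hx (sqDist_comm x y ▸ hD)
    rw [← G_comm, sqDist_comm y x] at B
    have : y.2 / √(sqDist x y) ≤ s⁻¹ * y.2 := by
      rw [mul_comm, ← div_eq_mul_inv]; gcongr
    nlinarith

/-- Lower bound of the Green function. -/
lemma G_ge {x y : ℝ × ℝ} (hx : x ∈ H) (hy : y ∈ H) {L : ℝ} (hL : 0 < L)
    (h : sqDist x y + 4 * x.2 * y.2 ≤ 9 * L ^ 2) (hD : 0 < sqDist x y) :
    x.2 / (29 * L ^ 2) * y.2 ≤ G x y := by
  have hx' : 0 < x.2 := hx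
  have hy' : 0 < y.2 := hy
  have h1 : 4 * x.2 * y.2 / (9 * L ^ 2) ≤ Real.log (1 + 4 * x.2 * y.2 / sqDist x y) := by
    refine le_trans ?_ (Real.one_sub_inv_le_log_of_pos (by positivity))
    have : 1 - (1 + 4 * x.2 * y.2 / sqDist x y)⁻¹ =
        4 * x.2 * y.2 / (sqDist x y + 4 * x.2 * y.2) := by
      field_simp
      ring
    rw [this]
    gcongr
  rw [G_def]
  have h2 : x.2 / (29 * L ^ 2) * y.2 ≤ 1 / (4 * π) * (4 * x.2 * y.2 / (9 * L ^ 2)) := by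
    have e : 1 / (4 * π) * (4 * x.2 * y.2 / (9 * L ^ 2)) = x.2 / (9 * π * L ^ 2) * y.2 := by
      field_simp
    rw [e]
    have := Real.pi_lt_d2
    gcongr
    linarith
  refine h2.trans (by gcongr)

lemma ae_coord_ne (x : ℝ × ℝ) : ∀ᵐ y : ℝ × ℝ, x.1 ≠ y.1 ∧ x.2 ≠ y.2 := by
  have h1 : ∀ᵐ y : ℝ × ℝ, y.1 ≠ x.1 :=
    Measure.quasiMeasurePreserving_fst.ae (Measure.ae_ne volume x.1)
  have h2 : ∀ᵐ y : ℝ × ℝ, y.2 ≠ x.2 :=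
    Measure.quasiMeasurePreserving_snd.ae (Measure.ae_ne volume x.2)
  filter_upwards [h1, h2] with y h1 h2 using ⟨h1.symm, h2.symm⟩

section Potential

variable {A : Set (ℝ × ℝ)} {x : ℝ × ℝ}

lemma integral_prodKernel_le {s : ℝ} (hs : 0 < s) :
    ∫ y in A, prodKernel s (x - y) ≤ 16 * s := by
  rw [← integral_prodKernel hs x]
  exact setIntegral_le_integral (integrable_prodKernel hs x)
    (Eventually.of_forall fun _ => prodKernel_nonneg _ _)

lemma integrableOn_G (hA : MeasurableSet A) (hAH : A ⊆ H)
    (hI : IntegrableOn (fun y : ℝ × ℝ => y.2) A) (hx : x ∈ H) : IntegrableOn (G x) A := by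
  refine Integrable.mono' (g := fun y => (1 : ℝ)⁻¹ * y.2 + 1 * prodKernel 1 (x - y))
    ((hI.const_mul _).add ((integrable_prodKernel one_pos x).integrableOn.const_mul _))
    (measurable_G.of_uncurry_left).aestronglyMeasurable ?_
  filter_upwards [ae_restrict_mem hA, ae_restrict_of_ae (ae_coord_ne x)] with y hy hn
  rw [Real.norm_of_nonneg (G_nonneg hx (hAH hy))]
  exact G_le_uniform one_pos hx (hAH hy) hn.1 hn.2

lemma integral_G_le_uniform (hA : MeasurableSet A) (hAH : A ⊆ H)
    (hI : IntegrableOn (fun y : ℝ × ℝ => y.2) A) (hx : x ∈ H) {s : ℝ} (hs : 0 < s) :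
    ∫ y in A, G x y ≤ s⁻¹ * (∫ y in A, y.2) + 16 * s ^ 2 := by
  have i1 : IntegrableOn (fun y : ℝ × ℝ => s⁻¹ * y.2) A := hI.const_mul _
  have i2 : IntegrableOn (fun y => s * prodKernel s (x - y)) A :=
    (integrable_prodKernel hs x).integrableOn.const_mul _
  calc ∫ y in A, G x y ≤ ∫ y in A, (s⁻¹ * y.2 + s * prodKernel s (x - y)) := by
        refine integral_mono_ae (integrableOn_G hA hAH hI hx) (i1.add i2) ?_
        filter_upwards [ae_restrict_mem hA, ae_restrict_of_ae (ae_coord_ne x)] with y hy hn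
        exact G_le_uniform hs hx (hAH hy) hn.1 hn.2
    _ = s⁻¹ * (∫ y in A, y.2) + s * ∫ y in A, prodKernel s (x - y) := by
        rw [integral_add i1 i2, integral_const_mul, integral_const_mul]
    _ ≤ _ := by
        have := mul_le_mul_of_nonneg_left (integral_prodKernel_le (A := A) (x := x) hs) hs.le
        nlinarith

lemma integral_G_le_linear (hA : MeasurableSet A) (hAH : A ⊆ H)
    (hI : IntegrableOn (fun y : ℝ × ℝ => y.2) A) (hx : x ∈ H) {s R : ℝ} (hs : 0 < s)
    (hR : 0 < R) :
    ∫ y in A, G x y ≤ x.2 / s ^ 2 * (∫ y in A ∩ Metric.ball x R, y.2)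
      + x.2 / R ^ 2 * (∫ y in A, y.2) + x.2 * (16 * s) := by
  have hx' : 0 < x.2 := hx
  have i0 : IntegrableOn (fun y : ℝ × ℝ => x.2 / s ^ 2 *
      (Metric.ball x R).indicator (fun y => y.2) y) A :=
    (hI.indicator Metric.isOpen_ball.measurableSet).const_mul _
  have i1 : IntegrableOn (fun y : ℝ × ℝ => x.2 / R ^ 2 * y.2) A := hI.const_mul _
  have i2 : IntegrableOn (fun y => x.2 * prodKernel s (x - y)) A :=
    (integrable_prodKernel hs x).integrableOn.const_mul _
  calc ∫ y in A, G x y ≤ ∫ y in A, (x.2 / s ^ 2 * (Metric.ball x R).indicator (fun y => y.2) y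
          + x.2 / R ^ 2 * y.2 + x.2 * prodKernel s (x - y)) := by
        refine integral_mono_ae (integrableOn_G hA hAH hI hx) ((i0.add i1).add i2) ?_
        filter_upwards [ae_restrict_mem hA, ae_restrict_of_ae (ae_coord_ne x)] with y hy hn
        exact G_le_linear hs hR hx (hAH hy) hn.1 hn.2
    _ = x.2 / s ^ 2 * (∫ y in A ∩ Metric.ball x R, y.2)
          + x.2 / R ^ 2 * (∫ y in A, y.2) + x.2 * ∫ y in A, prodKernel s (x - y) := by
        rw [integral_add (by exact i0.add i1) i2, integral_add i0 i1, integral_const_mul,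
          integral_const_mul, integral_const_mul,
          setIntegral_indicator Metric.isOpen_ball.measurableSet]
    _ ≤ _ := by
        gcongr
        exact integral_prodKernel_le hs

lemma integral_G_nonneg (hA : MeasurableSet A) (hAH : A ⊆ H) (hx : x ∈ H) :
    0 ≤ ∫ y in A, G x y :=
  setIntegral_nonneg hA fun _ hy => G_nonneg hx (hAH hy)

lemma integrableOn_integral_G (hA : MeasurableSet A) (hAH : A ⊆ H)
    (hI : IntegrableOn (fun y : ℝ × ℝ => y.2) A) (hfin : volume A < ⊤) :
    IntegrableOn (fun x => ∫ y in A, G x y) A := by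
  refine Integrable.mono' (g := fun _ => (1 : ℝ)⁻¹ * (∫ y in A, y.2) + 16 * 1 ^ 2)
    (integrableOn_const hfin.ne) ?_ ?_
  · exact (measurable_G.stronglyMeasurable.integral_prod_right).aestronglyMeasurable
  · filter_upwards [ae_restrict_mem hA] with z hz
    rw [Real.norm_of_nonneg (integral_G_nonneg hA hAH (hAH hz))]
    exact integral_G_le_uniform hA hAH hI (hAH hz) one_pos

/-- A potential of size at least `c l x₂` at `x` forces a fixed fraction of the impulse to lie
within distance of order `l` from `x`. -/
lemma impulse_ball_ge (hA : MeasurableSet A) (hAH : A ⊆ H)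
    (hI : IntegrableOn (fun y : ℝ × ℝ => y.2) A) (hx : x ∈ H) {l c : ℝ} (hl : 0 < l)
    (hc : 0 < c) (hc1 : c ≤ 1) (hM : ∫ y in A, y.2 = l ^ 3)
    (h : c * l * x.2 ≤ ∫ y in A, G x y) :
    c ^ 3 / 8192 * l ^ 3 ≤ ∫ y in A ∩ Metric.ball x (2 * l / c), y.2 := by
  have hx' : 0 < x.2 := hx
  have hs : 0 < c * l / 64 := by positivity
  have hR : 0 < 2 * l / c := by positivity
  have h1 := h.trans (integral_G_le_linear hA hAH hI hx hs hR)
  rw [hM] at h1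
  generalize ∫ y in A ∩ Metric.ball x (2 * l / c), y.2 = μ at h1 ⊢
  have e1 : x.2 / (c * l / 64) ^ 2 * μ = x.2 * (4096 / (c ^ 2 * l ^ 2) * μ) := by
    field_simp; ring
  have e2 : x.2 / (2 * l / c) ^ 2 * l ^ 3 = x.2 * (c ^ 2 * l / 4) := by
    field_simp; norm_num
  rw [e1, e2, mul_comm (c * l), ← mul_add, ← mul_add] at h1
  have h2 := le_of_mul_le_mul_left h1 hx'
  have h3 : c ^ 2 * l / 4 ≤ c * l / 4 := by
    have : c ^ 2 ≤ c := by nlinarith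
    gcongr
  have h4 : c * l / 2 ≤ 4096 / (c ^ 2 * l ^ 2) * μ := by linarith
  rw [div_mul_eq_mul_div, le_div_iff₀ (by positivity)] at h4
  linarith

/-- If the impulse concentrates around every point of `A` at scale `R`, the area is controlled. -/
lemma area_le_of_impulse_ball_ge (hA : MeasurableSet A) (hAH : A ⊆ H)
    (hI : IntegrableOn (fun y : ℝ × ℝ => y.2) A) {R μ : ℝ} (hR : 0 < R)
    (hμ : 0 ≤ μ) (h : ∀ᵐ x ∂volume.restrict A, μ ≤ ∫ y in A ∩ Metric.ball x R, y.2) :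
    μ * (volume A).toReal ≤ 4 * R ^ 2 * ∫ y in A, y.2 := by
  have hpos : 0 ≤ᵐ[volume.restrict A] fun y : ℝ × ℝ => y.2 := by
    filter_upwards [ae_restrict_mem hA] with y hy using (hAH hy).le
  have hball (x : ℝ × ℝ) : volume (Metric.ball x R) = ENNReal.ofReal (4 * R ^ 2) := by
    rw [← ball_prod_same, Measure.volume_eq_prod, Measure.prod_prod, Real.volume_ball,
      Real.volume_ball, ← ENNReal.ofReal_mul (by positivity)]
    ring_nf
  have hm : Measurable fun p : (ℝ × ℝ) × (ℝ × ℝ) =>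
      {p : (ℝ × ℝ) × (ℝ × ℝ) | dist p.2 p.1 < R}.indicator
        (fun p => ENNReal.ofReal p.2.2) p := by
    refine Measurable.indicator (by fun_prop) ?_
    exact measurableSet_lt (by fun_prop) measurable_const
  have key : ENNReal.ofReal μ * volume A ≤
      ENNReal.ofReal (4 * R ^ 2) * ENNReal.ofReal (∫ y in A, y.2) := by
    calc ENNReal.ofReal μ * volume A = ∫⁻ _ in A, ENNReal.ofReal μ := by
          rw [setLIntegral_const]
      _ ≤ ∫⁻ x in A, ∫⁻ y in A, {p : (ℝ × ℝ) × (ℝ × ℝ) | dist p.2 p.1 < R}.indicator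
            (fun p => ENNReal.ofReal p.2.2) (x, y) := by
          refine lintegral_mono_ae ?_
          filter_upwards [h] with x hx
          refine (ENNReal.ofReal_le_ofReal hx).trans (le_of_eq ?_)
          rw [← setIntegral_indicator Metric.isOpen_ball.measurableSet,
            ofReal_integral_eq_lintegral_ofReal
              (hI.indicator Metric.isOpen_ball.measurableSet)]
          · refine lintegral_congr fun y => ?_
            by_cases hy : dist y x < R <;> simp [indicator, hy]
          · filter_upwards [hpos] with y hy using indicator_apply_nonneg fun _ => hy
      _ = ∫⁻ y in A, ∫⁻ x in A, {p : (ℝ × ℝ) × (ℝ × ℝ) | dist p.2 p.1 < R}.indicator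
            (fun p => ENNReal.ofReal p.2.2) (x, y) :=
          lintegral_lintegral_swap hm.aemeasurable
      _ ≤ ∫⁻ y in A, ENNReal.ofReal (4 * R ^ 2) * ENNReal.ofReal y.2 := by
          refine lintegral_mono fun y => ?_
          refine (setLIntegral_le_lintegral _ _).trans ?_
          rw [← hball y, mul_comm, ← lintegral_indicator_const Metric.isOpen_ball.measurableSet]
          refine lintegral_mono fun x => ?_
          by_cases hy : dist y x < R
          · simp [indicator, hy, dist_comm x y]
          · simp [indicator, hy]
      _ = _ := by
          rw [lintegral_const_mul _ (by fun_prop), ofReal_integral_eq_lintegral_ofReal hI hpos]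
  rw [← ENNReal.ofReal_mul (by positivity)] at key
  have := ENNReal.toReal_mono ENNReal.ofReal_ne_top key
  rwa [ENNReal.toReal_mul, ENNReal.toReal_ofReal hμ, ENNReal.toReal_ofReal] at this
  exact mul_nonneg (by positivity) (integral_nonneg_of_ae hpos)

end Potential

section Patch

variable {A : Set (ℝ × ℝ)} {ω : ℝ × ℝ → ℝ}

lemma integral_mul_patch (hA : MeasurableSet A) (hAH : A ⊆ H)
    (hω : ∀ᵐ x ∂volume.restrict H, ω x = A.indicator (fun _ => (1 : ℝ)) x)
    (f : ℝ × ℝ → ℝ) : ∫ y in H, f y * ω y = ∫ y in A, f y := by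
  have : ∫ y in H, f y * ω y = ∫ y in H, A.indicator f y := by
    refine integral_congr_ae ?_
    filter_upwards [hω] with y hy
    rw [hy]
    by_cases h : y ∈ A <;> simp [h]
  rw [this, setIntegral_indicator hA, inter_eq_right.2 hAH]

lemma Gpot_patch (hA : MeasurableSet A) (hAH : A ⊆ H)
    (hω : ∀ᵐ x ∂volume.restrict H, ω x = A.indicator (fun _ => (1 : ℝ)) x) (x : ℝ × ℝ) :
    Gpot ω x = ∫ y in A, G x y :=
  integral_mul_patch hA hAH hω _

lemma energy_patch (hA : MeasurableSet A) (hAH : A ⊆ H)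
    (hω : ∀ᵐ x ∂volume.restrict H, ω x = A.indicator (fun _ => (1 : ℝ)) x) :
    energy ω = 1 / 2 * ∫ x in A, ∫ y in A, G x y := by
  unfold energy
  rw [← integral_mul_patch hA hAH hω]
  congr 2
  funext x
  rw [← integral_mul_patch hA hAH hω, ← integral_mul_const]
  congr 1
  funext y
  ring

lemma norm1_patch (hA : MeasurableSet A) (hAH : A ⊆ H)
    (hω : ∀ᵐ x ∂volume.restrict H, ω x = A.indicator (fun _ => (1 : ℝ)) x) :
    norm1 ω = (volume A).toReal := by
  have h : norm1 ω = ∫ x in H, 1 * ω x := by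
    refine integral_congr_ae ?_
    filter_upwards [hω] with y hy
    rw [hy]
    by_cases h : y ∈ A <;> simp [h]
  rw [h, integral_mul_patch hA hAH hω]
  simp [Measure.real]

end Patch

lemma integral_box_snd {a b c d : ℝ} (hab : a ≤ b) (hcd : c ≤ d) :
    ∫ z in Ioc a b ×ˢ Ioc c d, z.2 = (b - a) * ((d ^ 2 - c ^ 2) / 2) := by
  have := setIntegral_prod_mul (μ := (volume : Measure ℝ)) (ν := (volume : Measure ℝ))
    (fun _ => (1 : ℝ)) (fun t => t) (Ioc a b) (Ioc c d)
  rw [← intervalIntegral.integral_of_le hab, ← intervalIntegral.integral_of_le hcd,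
    integral_id] at this
  simpa [Measure.volume_eq_prod] using this

lemma integrableOn_box_snd (a b c d : ℝ) :
    IntegrableOn (fun z : ℝ × ℝ => z.2) (Ioc a b ×ˢ Ioc c d) :=
  (continuous_snd.continuousOn.integrableOn_compact (isCompact_Icc.prod isCompact_Icc)).mono_set
    (prod_mono Ioc_subset_Icc_self Ioc_subset_Icc_self)

lemma volume_box {a b : ℝ} (hab : a ≤ b) (c d : ℝ) :
    volume (Ioc a b ×ˢ Ioc c d) = ENNReal.ofReal ((b - a) * (d - c)) := by
  rw [Measure.volume_eq_prod, Measure.prod_prod, Real.volume_Ioc, Real.volume_Ioc,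
    ENNReal.ofReal_mul (by linarith)]

/-- A box of side comparable to `l` is admissible with impulse `l ^ 3` and energy of order
`l ^ 4`. -/
lemma exists_memK_energy_ge {l : ℝ} (hl : 0 < l) (hl1 : l ≤ 1) :
    ∃ ω, memK (l ^ 3) ω ∧ l ^ 4 / 60 ≤ energy ω := by
  set B : Set (ℝ × ℝ) := Ioc 0 (2 / 3 * l) ×ˢ Ioc l (2 * l) with hB
  have hBm : MeasurableSet B := measurableSet_Ioc.prod measurableSet_Ioc
  have hBH : B ⊆ H := fun x hx => hl.trans hx.2.1
  have hI : IntegrableOn (fun y : ℝ × ℝ => y.2) B := integrableOn_box_snd _ _ _ _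
  have hvol : volume B = ENNReal.ofReal (2 / 3 * l ^ 2) := by
    rw [hB, volume_box (by positivity)]; congr 1; ring
  have hfin : volume B < ⊤ := hvol ▸ ENNReal.ofReal_lt_top
  have hreal : volume.real B = 2 / 3 * l ^ 2 := by
    rw [Measure.real, hvol, ENNReal.toReal_ofReal (by positivity)]
  have hω : ∀ᵐ x ∂volume.restrict H,
      B.indicator (fun _ => (1 : ℝ)) x = B.indicator (fun _ => (1 : ℝ)) x :=
    Eventually.of_forall fun _ => rfl
  refine ⟨B.indicator fun _ => 1, ⟨?_, B, hBH, hBm, hω, ?_, ?_⟩, ?_⟩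
  · exact ((integrable_indicator_iff hBm).2 (integrableOn_const hfin.ne)).integrableOn
  · rw [hB, integral_box_snd (by positivity) (by linarith)]; ring
  · rw [hvol, ENNReal.ofReal_le_one]; nlinarith
  · have hG (x : ℝ × ℝ) (hx : x ∈ B) : 2 / 3 * l ^ 2 * (1 / 13) ≤ ∫ y in B, G x y := by
      rw [← hreal, ← smul_eq_mul, ← setIntegral_const]
      refine integral_mono_ae (integrableOn_const hfin.ne)
        (integrableOn_G hBm hBH hI (hBH hx)) ?_
      filter_upwards [ae_restrict_mem hBm, ae_restrict_of_ae (ae_coord_ne x)] with y hy hn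
      obtain ⟨⟨hx1, hx2⟩, hx3, hx4⟩ := hx
      obtain ⟨⟨hy1, hy2⟩, hy3, hy4⟩ := hy
      have hD := sqDist_pos hn.1
      have hD2 : sqDist x y ≤ 2 * l ^ 2 := by
        unfold sqDist
        nlinarith
      have hlog : 1 ≤ Real.log (1 + 4 * x.2 * y.2 / sqDist x y) := by
        have : 2 ≤ 4 * x.2 * y.2 / sqDist x y := by
          rw [le_div_iff₀ hD]
          nlinarith
        rw [Real.le_log_iff_exp_le (by linarith)]
        linarith [Real.exp_one_lt_d9]
      rw [G_def]
      have : (1 : ℝ) / 13 ≤ 1 / (4 * π) := by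
        have := Real.pi_lt_d2
        gcongr
        linarith
      calc (1 : ℝ) / 13 ≤ 1 / (4 * π) * 1 := by linarith
        _ ≤ _ := by gcongr
    rw [energy_patch hBm hBH hω]
    have : 2 / 3 * l ^ 2 * (2 / 3 * l ^ 2 * (1 / 13)) ≤ ∫ x in B, ∫ y in B, G x y := by
      conv_lhs => rw [← hreal, ← smul_eq_mul, ← setIntegral_const, hreal]
      exact setIntegral_mono_on (integrableOn_const hfin.ne)
        (integrableOn_integral_G hBm hBH hI hfin) hBm hG
    have : 0 < l ^ 4 := by positivity
    nlinarith

section Maximizer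

variable {A : Set (ℝ × ℝ)} {l : ℝ}

lemma integral_G_le_mul_sq (hA : MeasurableSet A) (hAH : A ⊆ H)
    (hI : IntegrableOn (fun y : ℝ × ℝ => y.2) A) (hl : 0 < l) (hM : ∫ y in A, y.2 = l ^ 3)
    {x : ℝ × ℝ} (hx : x ∈ H) : ∫ y in A, G x y ≤ 17 * l ^ 2 := by
  refine (integral_G_le_uniform hA hAH hI hx hl).trans (le_of_eq ?_)
  rw [hM]
  field_simp
  norm_num

lemma integral_G_le_mul_snd (hA : MeasurableSet A) (hAH : A ⊆ H)
    (hI : IntegrableOn (fun y : ℝ × ℝ => y.2) A) (hl : 0 < l) (hM : ∫ y in A, y.2 = l ^ 3)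
    {x : ℝ × ℝ} (hx : x ∈ H) : ∫ y in A, G x y ≤ 18 * l * x.2 := by
  have hx' : 0 < x.2 := hx
  refine (integral_G_le_linear hA hAH hI hx hl hl).trans ?_
  have : ∫ y in A ∩ Metric.ball x l, y.2 ≤ l ^ 3 := by
    rw [← hM]
    refine setIntegral_mono_set hI ?_ inter_subset_left.eventuallyLE
    filter_upwards [ae_restrict_mem hA] with y hy using (hAH hy).le
  calc _ ≤ x.2 / l ^ 2 * l ^ 3 + x.2 / l ^ 2 * l ^ 3 + x.2 * (16 * l) := by
        rw [hM]
        gcongr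
    _ = _ := by
        field_simp
        norm_num

lemma exists_integral_G_ge (hA : MeasurableSet A) (hAH : A ⊆ H)
    (hI : IntegrableOn (fun y : ℝ × ℝ => y.2) A) (hfin : volume A < ⊤) (hl : 0 < l)
    (hM : ∫ y in A, y.2 = l ^ 3) (hE : l ^ 4 / 30 ≤ ∫ x in A, ∫ y in A, G x y) :
    ∃ x ∈ A, 1 / 40 * l * x.2 ≤ ∫ y in A, G x y := by
  by_contra! h
  have : ∫ x in A, ∫ y in A, G x y ≤ ∫ x in A, 1 / 40 * l * x.2 :=
    setIntegral_mono_on (integrableOn_integral_G hA hAH hI hfin) (hI.const_mul _) hA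
      fun x hx => (h x hx).le
  rw [integral_const_mul, hM] at this
  have : 0 < l ^ 4 := by positivity
  nlinarith

/-- Lower bound of the travelling speed. -/
lemma speed_ge (hA : MeasurableSet A) (hAH : A ⊆ H)
    (hI : IntegrableOn (fun y : ℝ × ℝ => y.2) A) (hfin : volume A < ⊤) (hl : 0 < l)
    (hM : ∫ y in A, y.2 = l ^ 3) (hE : l ^ 4 / 30 ≤ ∫ x in A, ∫ y in A, G x y) {W : ℝ}
    (hW : ∀ᵐ z ∂volume.restrict H, W * z.2 < (∫ y in A, G z y) → z ∈ A) :
    1 / 10 ^ 16 * l ≤ W := by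
  by_contra! hlt
  obtain ⟨x, hxA, hx⟩ := exists_integral_G_ge hA hAH hI hfin hl hM hE
  have hxH := hAH hxA
  have hμ := impulse_ball_ge hA hAH hI hxH hl (by norm_num) (by norm_num) hM hx
  have hx2 : x.2 ≤ 680 * l := by
    have := hx.trans (integral_G_le_mul_sq hA hAH hI hl hM hxH)
    have : l * x.2 ≤ l * (680 * l) := by nlinarith
    exact le_of_mul_le_mul_left this hl
  rw [show 2 * l / (1 / 40) = 80 * l by ring] at hμ
  set L := 760 * l with hL
  have hLpos : 0 < L := by positivity
  set B : Set (ℝ × ℝ) := Ioc (x.1 - L) (x.1 + L) ×ˢ Ioc 0 L with hB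
  have hBm : MeasurableSet B := measurableSet_Ioc.prod measurableSet_Ioc
  have hBH : B ⊆ H := fun z hz => hz.2.1
  have hlow (z : ℝ × ℝ) (hz : z ∈ B) : W * z.2 < ∫ y in A, G z y := by
    have hzH := hBH hz
    obtain ⟨⟨hz1, hz2⟩, hz3, hz4⟩ := hz
    have hS : MeasurableSet (A ∩ Metric.ball x (80 * l)) :=
      hA.inter Metric.isOpen_ball.measurableSet
    have h1 : ∫ y in A ∩ Metric.ball x (80 * l), z.2 / (29 * L ^ 2) * y.2 ≤
        ∫ y in A ∩ Metric.ball x (80 * l), G z y := by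
      refine integral_mono_ae ((hI.mono_set inter_subset_left).const_mul _)
        ((integrableOn_G hA hAH hI hzH).mono_set inter_subset_left) ?_
      filter_upwards [ae_restrict_mem hS, ae_restrict_of_ae (ae_coord_ne z)] with y hy hn
      have hyH := hAH hy.1
      have hy' : 0 < y.2 := hyH
      have hd := Metric.mem_ball.1 hy.2
      rw [Prod.dist_eq, max_lt_iff, Real.dist_eq, Real.dist_eq, abs_lt, abs_lt] at hd
      refine G_ge hzH hyH hLpos ?_ (sqDist_pos hn.1)
      have e1 : (z.1 - y.1) ^ 2 ≤ (2 * L) ^ 2 := by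
        apply sq_le_sq' <;> linarith
      have e2 : (z.2 - y.2) ^ 2 ≤ L ^ 2 := by
        apply sq_le_sq' <;> linarith
      have e3 : z.2 * y.2 ≤ L * L := by
        gcongr
        linarith
      unfold sqDist
      nlinarith
    have h2 : ∫ y in A ∩ Metric.ball x (80 * l), G z y ≤ ∫ y in A, G z y := by
      refine setIntegral_mono_set (integrableOn_G hA hAH hI hzH) ?_
        inter_subset_left.eventuallyLE
      filter_upwards [ae_restrict_mem hA] with y hy using G_nonneg hzH (hAH hy)
    rw [integral_const_mul] at h1
    have h3 : 1 / 10 ^ 16 * l * z.2 ≤ z.2 / (29 * L ^ 2) * ((1 / 40) ^ 3 / 8192 * l ^ 3) := by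
      have : z.2 / (29 * L ^ 2) * ((1 / 40) ^ 3 / 8192 * l ^ 3) =
          (1 / 40) ^ 3 / 8192 / (29 * 760 ^ 2) * (l * z.2) := by
        rw [hL]
        field_simp
      rw [this, mul_assoc]
      exact mul_le_mul_of_nonneg_right (by norm_num) (by positivity)
    have h4 : W * z.2 < 1 / 10 ^ 16 * l * z.2 := by gcongr
    have h5 := mul_le_mul_of_nonneg_left hμ (show 0 ≤ z.2 / (29 * L ^ 2) by positivity)
    linarith
  have hsub : B ≤ᵐ[volume] A := by
    have := (ae_restrict_iff' measurableSet_H).1 hW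
    filter_upwards [this] with z hz hzB
    exact hz (hBH hzB) (hlow z hzB)
  have himp : ∫ z in B, z.2 ≤ ∫ z in A, z.2 := by
    refine setIntegral_mono_set hI ?_ hsub
    filter_upwards [ae_restrict_mem hA] with y hy using (hAH hy).le
  rw [hM, hB, integral_box_snd (by linarith) hLpos.le, hL] at himp
  have : 0 < l ^ 3 := by positivity
  nlinarith

/-- Upper bound of the area. -/
lemma area_le (hA : MeasurableSet A) (hAH : A ⊆ H)
    (hI : IntegrableOn (fun y : ℝ × ℝ => y.2) A) (hl : 0 < l)
    (hM : ∫ y in A, y.2 = l ^ 3) {c : ℝ} (hc : 0 < c) (hc1 : c ≤ 1)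
    (h : ∀ᵐ x ∂volume.restrict A, c * l * x.2 ≤ ∫ y in A, G x y) :
    (volume A).toReal ≤ 131072 / c ^ 5 * l ^ 2 := by
  have h1 := area_le_of_impulse_ball_ge (R := 2 * l / c) (μ := c ^ 3 / 8192 * l ^ 3) hA hAH hI
    (by positivity) (by positivity) (by
      filter_upwards [h, ae_restrict_mem hA] with x hx hxA
      exact impulse_ball_ge hA hAH hI (hAH hxA) hl hc hc1 hM hx)
  rw [hM] at h1
  have e : 4 * (2 * l / c) ^ 2 * l ^ 3 =
      c ^ 3 / 8192 * l ^ 3 * (131072 / c ^ 5 * l ^ 2) := by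
    field_simp
    norm_num
  rw [e] at h1
  exact le_of_mul_le_mul_left h1 (by positivity)

end Maximizer

/-- small-impulse estimates on mass, energy, traveling speed and
potential of maximizers. -/
theorem small_impulse_estimates :
    ∃ C : ℝ, 1 ≤ C ∧ ∃ M₁ : ℝ, 0 < M₁ ∧
    ∀ (M W : ℝ) (ω : ℝ × ℝ → ℝ), 0 < M → M < M₁ → 0 < W → memS M ω →
      (∀ᵐ x ∂volume.restrict H,
        ω x = Set.indicator {y ∈ H | 0 < Gpot ω y - W * y.2} (fun _ => (1 : ℝ)) x) →
      (C⁻¹ * M ^ ((2 : ℝ) / 3) ≤ norm1 ω ∧ norm1 ω ≤ C * M ^ ((2 : ℝ) / 3)) ∧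
      (C⁻¹ * M ^ ((4 : ℝ) / 3) ≤ energy ω ∧ energy ω ≤ C * M ^ ((4 : ℝ) / 3)) ∧
      (C⁻¹ * M ^ ((1 : ℝ) / 3) ≤ W ∧ W ≤ C * M ^ ((1 : ℝ) / 3)) ∧
      (∀ x ∈ H, |Gpot ω x| ≤ C * M ^ ((2 : ℝ) / 3)) := by
  refine ⟨10 ^ 86, by norm_num, 1, one_pos, ?_⟩
  rintro M W ω hM0 hM1 hW ⟨⟨-, A, hAH, hA, hω, hM, hvol⟩, hmax⟩ hrep
  obtain ⟨l, hl⟩ : ∃ l, l = M ^ ((1 : ℝ) / 3) := ⟨_, rfl⟩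
  have hl0 : 0 < l := hl ▸ Real.rpow_pos_of_pos hM0 _
  have hl1 : l ≤ 1 := hl ▸ Real.rpow_le_one hM0.le hM1.le (by norm_num)
  have hl2 : M ^ ((2 : ℝ) / 3) = l ^ 2 := by
    rw [hl, ← Real.rpow_mul_natCast hM0.le]; norm_num
  have hl3 : M = l ^ 3 := by
    rw [hl, ← Real.rpow_mul_natCast hM0.le]; norm_num
  have hl4 : M ^ ((4 : ℝ) / 3) = l ^ 4 := by
    rw [hl, ← Real.rpow_mul_natCast hM0.le]; norm_num
  rw [hl2, hl4, ← hl]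
  rw [hl3] at hM hmax
  have hfin : volume A < ⊤ := hvol.trans_lt ENNReal.one_lt_top
  have hI : IntegrableOn (fun y : ℝ × ℝ => y.2) A := by
    by_contra h
    rw [integral_undef h] at hM
    exact (pow_pos hl0 3).ne hM
  have hE := energy_patch hA hAH hω
  have hpot := Gpot_patch hA hAH hω
  have hEge : l ^ 4 / 60 ≤ energy ω := by
    obtain ⟨ω', hω', hle⟩ := exists_memK_energy_ge hl0 hl1
    exact hle.trans (hmax ω' hω')
  have hmem : ∀ᵐ z ∂volume.restrict H, (z ∈ A ↔ W * z.2 < ∫ y in A, G z y) := by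
    classical
    filter_upwards [hω, hrep, ae_restrict_mem measurableSet_H] with z h1 h2 hz
    rw [h1, indicator_apply, indicator_apply] at h2
    simp only [mem_ofPred_eq, hz, true_and, sub_pos, hpot] at h2
    split_ifs at h2 with hzA hzW hzW
    · exact iff_of_true hzA hzW
    · exact absurd h2 one_ne_zero
    · exact absurd h2 zero_ne_one
    · exact iff_of_false hzA hzW
  have hUint := integrableOn_integral_G hA hAH hI hfin
  have hlow := speed_ge hA hAH hI hfin hl0 hM (by linarith) (hmem.mono fun z hz => hz.2)
  have hAmem : ∀ᵐ z ∂volume.restrict A, W * z.2 ≤ ∫ y in A, G z y := by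
    filter_upwards [ae_restrict_of_ae_restrict_of_subset hAH hmem, ae_restrict_mem hA]
      with z h1 h2 using (h1.1 h2).le
  have harea : (volume A).toReal ≤ 131072 / (1 / 10 ^ 16) ^ 5 * l ^ 2 := by
    refine area_le hA hAH hI hl0 hM (by norm_num) (by norm_num) ?_
    filter_upwards [hAmem, ae_restrict_mem hA] with z hz hzA
    have : 0 < z.2 := hAH hzA
    exact le_trans (by gcongr) hz
  have hE1 : ∫ x in A, ∫ y in A, G x y ≤ 18 * l ^ 4 := by
    calc _ ≤ ∫ x in A, 18 * l * x.2 := setIntegral_mono_on hUint (hI.const_mul _) hA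
          fun x hx => integral_G_le_mul_snd hA hAH hI hl0 hM (hAH hx)
      _ = _ := by rw [integral_const_mul, hM]; ring
  have hE2 : ∫ x in A, ∫ y in A, G x y ≤ (volume A).toReal * (17 * l ^ 2) := by
    calc _ ≤ ∫ x in A, 17 * l ^ 2 := setIntegral_mono_on hUint
          (integrableOn_const hfin.ne) hA
          fun x hx => integral_G_le_mul_sq hA hAH hI hl0 hM (hAH hx)
      _ = _ := by rw [setIntegral_const, smul_eq_mul, Measure.real]
  have hE3 : W * l ^ 3 ≤ ∫ x in A, ∫ y in A, G x y := by
    rw [← hM, ← integral_const_mul]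
    exact integral_mono_ae (hI.const_mul _) hUint hAmem
  have hp2 : 0 < l ^ 2 := by positivity
  have hp3 : 0 < l ^ 3 := by positivity
  have hp4 : 0 < l ^ 4 := by positivity
  rw [norm1_patch hA hAH hω]
  refine ⟨⟨?_, ?_⟩, ⟨?_, ?_⟩, ⟨?_, ?_⟩, ?_⟩
  · have : l ^ 2 * (l ^ 2 / 510) ≤ l ^ 2 * (volume A).toReal := by nlinarith
    have := le_of_mul_le_mul_left this hp2
    norm_num at this ⊢
    linarith
  · norm_num at harea ⊢
    linarith
  · norm_num at hEge ⊢
    linarith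
  · norm_num
    linarith
  · norm_num at hlow ⊢
    linarith
  · have : l ^ 3 * W ≤ l ^ 3 * (18 * l) := by nlinarith
    have := le_of_mul_le_mul_left this hp3
    norm_num
    linarith
  · intro x hx
    rw [hpot, abs_of_nonneg (integral_G_nonneg hA hAH hx)]
    have := integral_G_le_mul_sq hA hAH hI hl0 hM hx
    norm_num
    linarith
end
end
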